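/- Let s : 𝕋 → ℝ be the sawtooth function s(x) = ι(x) − 1/2. Then for Haar-almost every α ∈ 𝕋 and for every x₀ ∈ 𝕋, the Birkhoff sums S_N(s,α,x₀) do not satisfy a temporal distributional limit theorem: there do not exist a real sequence (A_M), a positive sequence (B_M) with B_M → ∞, and a non-constant real random variable Y such that for every a ∈ ℝ, (1/M)·#{1 ≤ N ≤ M : (S_N(s,α,x₀) − A_M)/B_M ≤ a} → P[Y ≤ a] as M → ∞. -/

import Mathlib

open MeasureTheory Filter Set Topology

noncomputable def toCircle (x : ℝ) : UnitAddCircle := x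

/-- The canonical embedding `ι : 𝕋 → [0,1) ⊆ ℝ`. -/
noncomputable def iota (x : UnitAddCircle) : ℝ := (AddCircle.equivIco 1 0 x : ℝ)

/-- The Birkhoff sum `S_N(f, α, x₀) = ∑_{k=0}^{N-1} f(x₀ + kα)`. -/
noncomputable def birkhoff (f : UnitAddCircle → ℝ) (α x₀ : UnitAddCircle) (N : ℕ) : ℝ :=
  ∑ k ∈ Finset.range N, f (x₀ + k • α)

open scoped Classical in
/-- `S_N(f, α, x₀)` satisfies a temporal distributional limit theorem: there are
centering constants `A M`, scaling constants `B M > 0` with `B M → ∞`, and a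
non-(a.s.-)constant real random variable `Y` such that, with `N` uniform on
`{1, …, M}`, `(S_N - A_M)/B_M` converges in distribution to `Y` as `M → ∞`. -/
def SatisfiesTDLT (f : UnitAddCircle → ℝ) (α x₀ : UnitAddCircle) : Prop :=
  ∃ (A B : ℕ → ℝ) (Ω : Type) (_ : MeasurableSpace Ω) (P : Measure Ω) (Y : Ω → ℝ),
    (∀ M, 0 < B M) ∧ Filter.Tendsto B Filter.atTop Filter.atTop ∧
    IsProbabilityMeasure P ∧ Measurable Y ∧
    (¬ ∃ c : ℝ, ∀ᵐ ω ∂P, Y ω = c) ∧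
    ∀ a : ℝ, Filter.Tendsto
      (fun M : ℕ => (((Finset.Icc 1 M).filter
        (fun N => (birkhoff f α x₀ N - A M) / B M ≤ a)).card : ℝ) / M)
      Filter.atTop (nhds (P {ω | Y ω ≤ a}).toReal)

/-- The `1`-periodic antiderivative of the sawtooth function. -/
noncomputable def sawPrimitive (w : ℝ) : ℝ := (Int.fract w ^ 2 - Int.fract w) / 2

/-- Birkhoff sum of the sawtooth function along the rational rotation by `p / q`. -/
noncomputable def rationalSawSum (q : ℕ) (p : ℤ) (y : ℝ) (r : ℕ) : ℝ :=
  ∑ i ∈ Finset.range r, (Int.fract (y + i * (p / q : ℝ)) - 1 / 2)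

lemma fract_intCast_add_div (q : ℕ) [NeZero q] (n : ℤ) {t : ℝ} (h0 : 0 ≤ t) (h1 : t < 1) :
    Int.fract ((n + t) / q : ℝ) = (((n : ZMod q).val : ℝ) + t) / q := by
  have hq : (0 : ℝ) < q := by exact_mod_cast Nat.pos_of_ne_zero (NeZero.ne q)
  rw [Int.fract_eq_iff]
  have hv : (((n : ZMod q).val : ℕ) : ℤ) = n % q := ZMod.val_intCast n
  have hlt : (n : ZMod q).val + 1 ≤ q := ZMod.val_lt _
  have hlt' : (((n : ZMod q).val : ℝ)) + 1 ≤ q := by exact_mod_cast hlt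
  refine ⟨by positivity, by rw [div_lt_one hq]; linarith, n / q, ?_⟩
  have h2 : (n : ℤ) = (n : ZMod q).val + q * (n / q) := by
    rw [hv]; exact (Int.emod_add_mul_ediv n q).symm
  have h3 : (n : ℝ) = (n : ZMod q).val + q * ((n / q : ℤ) : ℝ) := by exact_mod_cast h2
  field_simp
  linarith

lemma sum_range_zmod {M : Type*} [AddCommMonoid M] (q : ℕ) [NeZero q] (g : ZMod q → M) :
    ∑ i ∈ Finset.range q, g i = ∑ z : ZMod q, g z := by
  refine Finset.sum_bij (fun i _ => (i : ZMod q)) (by simp) ?_ ?_ (by simp)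
  · intro a ha b hb h
    have := (ZMod.natCast_eq_natCast_iff' a b q).1 h
    rwa [Nat.mod_eq_of_lt (Finset.mem_range.1 ha), Nat.mod_eq_of_lt (Finset.mem_range.1 hb)] at this
  · intro z _
    exact ⟨z.val, Finset.mem_range.2 (ZMod.val_lt z), by simp⟩

lemma fract_rational_orbit (q : ℕ) [NeZero q] (p : ℤ) (y : ℝ) (i : ℕ) :
    Int.fract (y + i * (p / q : ℝ)) =
      (((⌊q * y⌋ + p * i : ZMod q).val : ℝ) + Int.fract (q * y)) / q := by
  have hq : (q : ℝ) ≠ 0 := by exact_mod_cast NeZero.ne q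
  have h := fract_intCast_add_div q (⌊q * y⌋ + p * i) (Int.fract_nonneg (q * y))
    (Int.fract_lt_one (q * y))
  push_cast at h
  have e : y + i * (p / q : ℝ) = (q * y + p * i) / q := by field_simp
  have := Int.floor_add_fract (q * y)
  rw [← h, e]
  congr 2
  linarith

lemma sum_zmod_val (q : ℕ) [NeZero q] : ∑ z : ZMod q, (z.val : ℝ) = q * (q - 1) / 2 := by
  rw [← sum_range_zmod q (fun z : ZMod q => (z.val : ℝ))]
  trans ∑ i ∈ Finset.range q, (i : ℝ)
  swap
  · have hq : 1 ≤ q := Nat.pos_of_ne_zero (NeZero.ne q)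
    have := Finset.sum_range_id_mul_two q
    have h : ((∑ i ∈ Finset.range q, i : ℕ) : ℝ) * 2 = q * (q - 1) := by
      rw [← Nat.cast_one (R := ℝ), ← Nat.cast_sub hq]; exact_mod_cast this
    push_cast at h
    linarith
  · refine Finset.sum_congr rfl fun i hi => ?_
    rw [ZMod.val_cast_of_lt (Finset.mem_range.1 hi)]

lemma sum_fract_rational_orbit (q : ℕ) [NeZero q] (p : ℤ) (hp : IsUnit (p : ZMod q)) (y : ℝ) :
    ∑ i ∈ Finset.range q, Int.fract (y + i * (p / q : ℝ)) = Int.fract (q * y) + (q - 1) / 2 := by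
  have hq : (q : ℝ) ≠ 0 := by exact_mod_cast NeZero.ne q
  simp_rw [fract_rational_orbit q p y]
  rw [sum_range_zmod q (fun z : ZMod q =>
    (((⌊q * y⌋ + p * z : ZMod q).val : ℝ) + Int.fract (q * y)) / q)]
  obtain ⟨u, hu⟩ := hp
  rw [← hu]
  have := Equiv.sum_comp ((Units.mulLeft u).trans (Equiv.addLeft (⌊q * y⌋ : ZMod q)))
    (fun z : ZMod q => ((z.val : ℝ) + Int.fract (q * y)) / q)
  simp only [Equiv.trans_apply, Units.mulLeft_apply, Equiv.coe_addLeft] at this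
  rw [this, ← Finset.sum_div, Finset.sum_add_distrib, sum_zmod_val]
  simp [ZMod.card]
  field_simp
  ring

lemma sum_floor_sub (q : ℕ) [NeZero q] (p : ℤ) (hp : IsUnit (p : ZMod q)) (y y' : ℝ) :
    ∑ i ∈ Finset.range q, ((⌊y' + i * (p / q : ℝ)⌋ : ℝ) - ⌊y + i * (p / q : ℝ)⌋) =
      ⌊q * y'⌋ - ⌊q * y⌋ := by
  have h (z : ℝ) : ∑ i ∈ Finset.range q, (⌊z + i * (p / q : ℝ)⌋ : ℝ) =
      ⌊q * z⌋ + (∑ i ∈ Finset.range q, (i * (p / q : ℝ)) - (q - 1) / 2) := by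
    have h1 : ∑ i ∈ Finset.range q, (⌊z + i * (p / q : ℝ)⌋ : ℝ) =
        ∑ i ∈ Finset.range q, ((z + i * (p / q : ℝ)) - Int.fract (z + i * (p / q : ℝ))) :=
      Finset.sum_congr rfl fun i _ => by rw [Int.self_sub_fract]
    rw [h1, Finset.sum_sub_distrib, sum_fract_rational_orbit q p hp z, Finset.sum_add_distrib]
    have := Int.self_sub_floor (q * z)
    simp only [Finset.sum_const, Finset.card_range, nsmul_eq_mul]
    linarith
  rw [Finset.sum_sub_distrib, h, h]
  ring

lemma abs_floor_sub_le_of_mul {z E c : ℝ} (h0 : 0 ≤ c) (h1 : c ≤ 1) :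
    |(⌊z + c * E⌋ : ℝ) - ⌊z⌋| ≤ |(⌊z + E⌋ : ℝ) - ⌊z⌋| := by
  rcases le_total 0 E with hE | hE
  · have a : (⌊z⌋ : ℝ) ≤ ⌊z + c * E⌋ := by
      exact_mod_cast Int.floor_le_floor (by nlinarith : z ≤ z + c * E)
    have b : (⌊z + c * E⌋ : ℝ) ≤ ⌊z + E⌋ := by
      exact_mod_cast Int.floor_le_floor (by nlinarith : z + c * E ≤ z + E)
    rw [abs_of_nonneg (by linarith), abs_of_nonneg (by linarith)]; linarith
  · have a : (⌊z + c * E⌋ : ℝ) ≤ ⌊z⌋ := by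
      exact_mod_cast Int.floor_le_floor (by nlinarith : z + c * E ≤ z)
    have b : (⌊z + E⌋ : ℝ) ≤ ⌊z + c * E⌋ := by
      exact_mod_cast Int.floor_le_floor (by nlinarith : z + E ≤ z + c * E)
    rw [abs_of_nonpos (by linarith), abs_of_nonpos (by linarith)]; linarith

lemma sum_abs_floor_sub (q : ℕ) [NeZero q] (p : ℤ) (hp : IsUnit (p : ZMod q)) (y E : ℝ) :
    ∑ i ∈ Finset.range q, |(⌊y + i * (p / q : ℝ) + E⌋ : ℝ) - ⌊y + i * (p / q : ℝ)⌋| =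
      |(⌊q * (y + E)⌋ : ℝ) - ⌊q * y⌋| := by
  have h := sum_floor_sub q p hp y (y + E)
  have hq : (0 : ℝ) ≤ q := by positivity
  rw [← h]
  simp_rw [add_right_comm y _ E]
  rcases le_total 0 E with hE | hE
  · have hn (i : ℕ) : 0 ≤ (⌊y + E + i * (p / q : ℝ)⌋ : ℝ) - ⌊y + i * (p / q : ℝ)⌋ := by
      rw [sub_nonneg]; exact_mod_cast Int.floor_le_floor (by linarith)
    rw [abs_of_nonneg (Finset.sum_nonneg fun i _ => hn i)]
    exact Finset.sum_congr rfl fun i _ => abs_of_nonneg (hn i)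
  · have hn (i : ℕ) : (⌊y + E + i * (p / q : ℝ)⌋ : ℝ) - ⌊y + i * (p / q : ℝ)⌋ ≤ 0 := by
      rw [sub_nonpos]; exact_mod_cast Int.floor_le_floor (by linarith)
    rw [abs_of_nonpos (Finset.sum_nonpos fun i _ => hn i), ← Finset.sum_neg_distrib]
    exact Finset.sum_congr rfl fun i _ => abs_of_nonpos (hn i)

lemma abs_sum_fract_shift_le (q : ℕ) [NeZero q] (p : ℤ) (hp : IsUnit (p : ZMod q)) (y E : ℝ)
    {r : ℕ} (hr : r ≤ q) (c : ℕ → ℝ) (h0 : ∀ i < r, 0 ≤ c i) (h1 : ∀ i < r, c i ≤ 1) :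
    |∑ i ∈ Finset.range r, (Int.fract (y + i * (p / q : ℝ) + c i * E) -
        Int.fract (y + i * (p / q : ℝ)))| ≤ q * |E| + |(⌊q * (y + E)⌋ : ℝ) - ⌊q * y⌋| := by
  calc _ ≤ ∑ i ∈ Finset.range r, (|E| +
        |(⌊y + i * (p / q : ℝ) + E⌋ : ℝ) - ⌊y + i * (p / q : ℝ)⌋|) := by
        refine (Finset.abs_sum_le_sum_abs _ _).trans (Finset.sum_le_sum fun i hi => ?_)
        have hi := Finset.mem_range.1 hi
        have e : Int.fract (y + i * (p / q : ℝ) + c i * E) - Int.fract (y + i * (p / q : ℝ)) =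
            c i * E - ((⌊y + i * (p / q : ℝ) + c i * E⌋ : ℝ) - ⌊y + i * (p / q : ℝ)⌋) := by
          unfold Int.fract; ring
        rw [e]
        refine (abs_sub _ _).trans (add_le_add ?_ (abs_floor_sub_le_of_mul (h0 i hi) (h1 i hi)))
        rw [abs_mul, abs_of_nonneg (h0 i hi)]
        exact mul_le_of_le_one_left (abs_nonneg _) (h1 i hi)
    _ ≤ ∑ i ∈ Finset.range q, (|E| +
        |(⌊y + i * (p / q : ℝ) + E⌋ : ℝ) - ⌊y + i * (p / q : ℝ)⌋|) := by
        refine Finset.sum_le_sum_of_subset_of_nonneg (Finset.range_mono hr) fun _ _ _ => by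
          positivity
    _ = _ := by
        rw [Finset.sum_add_distrib, sum_abs_floor_sub q p hp]; simp

lemma abs_sawPrimitive_le_dist_int (w : ℝ) (n : ℤ) (h0 : n - 1 ≤ w) :
    |sawPrimitive w| ≤ |w - n| / 2 := by
  have hf0 := Int.fract_nonneg w
  have hf1 := (Int.fract_lt_one w).le
  have key (a : ℝ) (ha : Int.fract w ≤ a ∨ 1 - Int.fract w ≤ a) :
      |sawPrimitive w| ≤ a / 2 := by
    unfold sawPrimitive
    rw [abs_le]
    constructor <;> rcases ha with ha | ha <;> nlinarith
  apply key
  rcases lt_or_ge w n with h | h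
  · right
    have : ⌊w⌋ = n - 1 := Int.floor_eq_iff.2 (by push_cast; constructor <;> linarith)
    unfold Int.fract
    rw [this, abs_of_nonpos (by linarith)]; push_cast; linarith
  · left
    have : (n : ℝ) ≤ ⌊w⌋ := by exact_mod_cast Int.le_floor.2 h
    unfold Int.fract
    rw [abs_of_nonneg (by linarith)]; linarith

lemma abs_sawPrimitive_sub_le (v w : ℝ) : |sawPrimitive v - sawPrimitive w| ≤ |v - w| / 2 := by
  wlog hvw : ⌊v⌋ ≤ ⌊w⌋ generalizing v w
  · rw [abs_sub_comm, abs_sub_comm v]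
    exact this w v (le_of_not_ge hvw)
  have hv0 := Int.floor_le v
  have hv1 := Int.lt_floor_add_one v
  have hw0 := Int.floor_le w
  have hw1 := Int.lt_floor_add_one w
  rcases hvw.eq_or_lt with h | h
  · have e : sawPrimitive v - sawPrimitive w =
        (v - w) / 2 * (Int.fract v + Int.fract w - 1) := by
      unfold sawPrimitive Int.fract
      rw [h]
      ring
    rw [e, abs_mul, abs_div, abs_of_pos (two_pos : (0 : ℝ) < 2)]
    refine mul_le_of_le_one_right (by positivity) (abs_le.2 ?_)
    have := Int.fract_nonneg v
    have := Int.fract_nonneg w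
    have := Int.fract_lt_one v
    have := Int.fract_lt_one w
    constructor <;> linarith
  · have hh : (⌊v⌋ : ℝ) + 1 ≤ ⌊w⌋ := by exact_mod_cast h
    have a := abs_sawPrimitive_le_dist_int v (⌊v⌋ + 1) (by push_cast; linarith)
    have b := abs_sawPrimitive_le_dist_int w ⌊w⌋ (by linarith)
    push_cast at a
    rw [abs_of_nonpos (by linarith : v - (⌊v⌋ + 1) ≤ 0)] at a
    rw [abs_of_nonneg (by linarith : 0 ≤ w - ⌊w⌋)] at b
    rw [abs_of_nonpos (by linarith : v - w ≤ 0)]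
    refine (abs_sub _ _).trans (by linarith)

lemma sawPrimitive_step (w d : ℝ) :
    |sawPrimitive (w + d) - sawPrimitive w - d * (Int.fract w - 1 / 2)| ≤
      d ^ 2 / 2 + |d| * |(⌊w + d⌋ : ℝ) - ⌊w⌋| := by
  by_cases h : ⌊w + d⌋ = ⌊w⌋
  · have : Int.fract (w + d) = Int.fract w + d := by unfold Int.fract; rw [h]; ring
    unfold sawPrimitive
    rw [this, h]
    have e : ((Int.fract w + d) ^ 2 - (Int.fract w + d)) / 2 -
      (Int.fract w ^ 2 - Int.fract w) / 2 - d * (Int.fract w - 1 / 2) = d ^ 2 / 2 := by ring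
    rw [e, abs_of_nonneg (by positivity)]
    simp
  · have hf0 := Int.fract_nonneg w
    have hf1 := (Int.fract_lt_one w).le
    have hJ : 1 ≤ |(⌊w + d⌋ : ℝ) - ⌊w⌋| := by
      have : 1 ≤ |⌊w + d⌋ - ⌊w⌋| := Int.one_le_abs (sub_ne_zero.2 h)
      exact_mod_cast this
    have h1 : |sawPrimitive (w + d) - sawPrimitive w| ≤ |d| / 2 := by
      simpa using abs_sawPrimitive_sub_le (w + d) w
    have h2 : |d * (Int.fract w - 1 / 2)| ≤ |d| * (1 / 2) := by
      rw [abs_mul]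
      refine mul_le_mul_of_nonneg_left ?_ (abs_nonneg d)
      rw [abs_le]; constructor <;> linarith
    have h3 : |d| ≤ |d| * |(⌊w + d⌋ : ℝ) - ⌊w⌋| := le_mul_of_one_le_right (abs_nonneg d) hJ
    refine (abs_sub _ _).trans ?_
    nlinarith [sq_nonneg d]

lemma abs_floor_sub_floor_le (w e : ℝ) : |(⌊w + e⌋ : ℝ) - ⌊w⌋| ≤ |e| + 1 := by
  have hw0 := Int.floor_le w
  have hw1 := Int.lt_floor_add_one w
  have hv0 := Int.floor_le (w + e)
  have hv1 := Int.lt_floor_add_one (w + e)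
  have := le_abs_self e
  have := neg_abs_le e
  rw [abs_le]; constructor <;> linarith

lemma sum_abs_floor_steps (w d : ℝ) (k : ℕ) :
    ∑ j ∈ Finset.range k, |(⌊w + (j + 1 : ℕ) * d⌋ : ℝ) - ⌊w + (j : ℕ) * d⌋| ≤ k * |d| + 1 := by
  have key : ∑ j ∈ Finset.range k, |(⌊w + (j + 1 : ℕ) * d⌋ : ℝ) - ⌊w + (j : ℕ) * d⌋| =
      |(⌊w + k * d⌋ : ℝ) - ⌊w⌋| := by
    have tel := Finset.sum_range_sub (fun j : ℕ => (⌊w + (j : ℕ) * d⌋ : ℝ)) k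
    simp only [Nat.cast_zero, zero_mul, add_zero] at tel
    rw [← tel]
    rcases le_total 0 d with hd | hd
    · have hn (j : ℕ) : 0 ≤ (⌊w + (j + 1 : ℕ) * d⌋ : ℝ) - ⌊w + (j : ℕ) * d⌋ := by
        rw [sub_nonneg]; exact_mod_cast Int.floor_le_floor (by push_cast; linarith)
      rw [abs_of_nonneg (Finset.sum_nonneg fun i _ => hn i)]
      exact Finset.sum_congr rfl fun i _ => abs_of_nonneg (hn i)
    · have hn (j : ℕ) : (⌊w + (j + 1 : ℕ) * d⌋ : ℝ) - ⌊w + (j : ℕ) * d⌋ ≤ 0 := by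
        rw [sub_nonpos]; exact_mod_cast Int.floor_le_floor (by push_cast; linarith)
      rw [abs_of_nonpos (Finset.sum_nonpos fun i _ => hn i), ← Finset.sum_neg_distrib]
      exact Finset.sum_congr rfl fun i _ => abs_of_nonpos (hn i)
  rw [key]
  refine (abs_floor_sub_floor_le _ _).trans ?_
  rw [abs_mul, Nat.abs_cast]

lemma abs_sum_saw_sub_sawPrimitive_le (w d : ℝ) (hd0 : d ≠ 0) (k : ℕ) :
    |∑ j ∈ Finset.range k, (Int.fract (w + j * d) - 1 / 2) -
      d⁻¹ * (sawPrimitive (w + k * d) - sawPrimitive w)| ≤ 3 / 2 * (k * |d|) + 1 := by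
  have hpos : 0 < |d| := abs_pos.2 hd0
  have tel := Finset.sum_range_sub (fun j : ℕ => sawPrimitive (w + (j : ℕ) * d)) k
  simp only [Nat.cast_zero, zero_mul, add_zero] at tel
  have e : ∑ j ∈ Finset.range k, (Int.fract (w + j * d) - 1 / 2) -
      d⁻¹ * (sawPrimitive (w + k * d) - sawPrimitive w) =
      -(d⁻¹ * ∑ j ∈ Finset.range k, (sawPrimitive (w + (j + 1 : ℕ) * d) - sawPrimitive (w + j * d)
        - d * (Int.fract (w + j * d) - 1 / 2))) := by
    rw [Finset.sum_sub_distrib _ (fun j : ℕ => d * (Int.fract (w + j * d) - 1 / 2)), tel,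
      ← Finset.mul_sum, mul_sub d⁻¹ _ (d * _), inv_mul_cancel_left₀ hd0]
    ring
  rw [e, abs_neg, abs_mul, abs_inv, inv_mul_le_iff₀ hpos]
  calc _ ≤ ∑ j ∈ Finset.range k, (d ^ 2 / 2 +
        |d| * |(⌊w + (j + 1 : ℕ) * d⌋ : ℝ) - ⌊w + (j : ℕ) * d⌋|) := by
        refine (Finset.abs_sum_le_sum_abs _ _).trans (Finset.sum_le_sum fun j _ => ?_)
        have := sawPrimitive_step (w + j * d) d
        have e : w + j * d + d = w + (j + 1 : ℕ) * d := by push_cast; ring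
        rwa [e] at this
    _ ≤ k * (d ^ 2 / 2) + |d| * (k * |d| + 1) := by
        rw [Finset.sum_add_distrib, ← Finset.mul_sum]
        simp only [Finset.sum_const, Finset.card_range, nsmul_eq_mul]
        gcongr
        exact sum_abs_floor_steps w d k
    _ = _ := by rw [← sq_abs d]; ring

lemma sum_range_mul_add_eq {M : Type*} [AddCommMonoid M] (g : ℕ → M) (k q r : ℕ) :
    ∑ n ∈ Finset.range (k * q + r), g n =
      ∑ j ∈ Finset.range k, ∑ i ∈ Finset.range q, g (j * q + i) +
        ∑ i ∈ Finset.range r, g (k * q + i) := by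
  rw [Finset.sum_range_add]
  congr 1
  induction k with
  | zero => simp
  | succ k ih => rw [Finset.sum_range_succ, ← ih, add_mul, one_mul, Finset.sum_range_add]

/-- The Birkhoff sums of the sawtooth function along an orbit of a rotation by `p / q + ε` follow,
on the scale of `(q ^ 2 * ε)⁻¹`, a periodic parabolic curve. -/
lemma abs_sum_saw_near_rational (q : ℕ) [NeZero q] (p : ℤ) (hp : IsUnit (p : ZMod q))
    (x ε d : ℝ) (hd : d = q ^ 2 * ε) (hd0 : d ≠ 0) (hd1 : |d| ≤ 1) (k : ℕ) {r : ℕ} (hr : r < q) :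
    |∑ n ∈ Finset.range (k * q + r), (Int.fract (x + n * (p / q + ε : ℝ)) - 1 / 2) -
      rationalSawSum q p x r - d⁻¹ * (sawPrimitive (q * x + k * d) - sawPrimitive (q * x))| ≤
      6 * (k * |d|) + 5 := by
  have hq : (0 : ℝ) < q := by exact_mod_cast Nat.pos_of_ne_zero (NeZero.ne q)
  have hq' : (q : ℝ) ≠ 0 := hq.ne'
  have hfr (j i : ℕ) : Int.fract (x + (j * q + i : ℕ) * (p / q + ε : ℝ)) =
      Int.fract (x + j * (q * ε) + i * (p / q : ℝ) + (i / q : ℝ) * (q * ε)) := by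
    have : x + (j * q + i : ℕ) * (p / q + ε : ℝ) =
        x + j * (q * ε) + i * (p / q : ℝ) + (i / q : ℝ) * (q * ε) + (j * p : ℤ) := by
      push_cast; field_simp; ring
    rw [this, Int.fract_add_intCast]
  have hfr' (i : ℕ) : Int.fract (x + (k * q + i : ℕ) * (p / q + ε : ℝ)) =
      Int.fract (x + i * (p / q : ℝ) + ((k + i / q) / (k + 1) : ℝ) * ((k + 1) * (q * ε))) := by
    rw [hfr]
    congr 1
    field_simp
    ring
  have hblock (j : ℕ) : |∑ i ∈ Finset.range q,
        (Int.fract (x + (j * q + i : ℕ) * (p / q + ε : ℝ)) - 1 / 2) -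
        (Int.fract (q * x + j * d) - 1 / 2)| ≤
      |d| + |(⌊q * x + (j + 1 : ℕ) * d⌋ : ℝ) - ⌊q * x + (j : ℕ) * d⌋| := by
    have h := abs_sum_fract_shift_le q p hp (x + j * (q * ε)) (q * ε) le_rfl (fun i => i / q)
      (fun i _ => by positivity) (fun i hi => by
        rw [div_le_one hq]; exact_mod_cast hi.le)
    rw [Finset.sum_sub_distrib, sum_fract_rational_orbit q p hp] at h
    simp_rw [hfr]
    rw [Finset.sum_sub_distrib]
    have e1 : (q : ℝ) * (x + j * (q * ε)) = q * x + j * d := by rw [hd]; ring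
    have e2 : (q : ℝ) * (x + j * (q * ε) + q * ε) = q * x + (j + 1 : ℕ) * d := by
      rw [hd]; push_cast; ring
    have e3 : (q : ℝ) * |q * ε| = |d| := by rw [hd, abs_mul, abs_mul, abs_pow]; simp; ring
    rw [e1, e2, e3] at h
    refine le_trans (le_of_eq ?_) h
    congr 1
    simp
    ring
  have hpart : |∑ i ∈ Finset.range r,
        (Int.fract (x + (k * q + i : ℕ) * (p / q + ε : ℝ)) - 1 / 2) - rationalSawSum q p x r| ≤
      2 * (k * |d|) + 3 := by
    have h := abs_sum_fract_shift_le q p hp x ((k + 1) * (q * ε)) hr.le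
      (fun i => (k + i / q) / (k + 1)) (fun i _ => by positivity) (fun i hi => by
        rw [div_le_one (by positivity)]
        have : (i / q : ℝ) ≤ 1 := by
          rw [div_le_one hq]; exact_mod_cast (hi.trans hr).le
        linarith)
    simp_rw [hfr']
    unfold rationalSawSum
    rw [← Finset.sum_sub_distrib]
    have e1 : (q : ℝ) * (x + (k + 1) * (q * ε)) = q * x + (k + 1) * d := by rw [hd]; ring
    have e3 : (q : ℝ) * |(k + 1) * (q * ε)| = (k + 1) * |d| := by
      rw [hd, abs_mul, abs_mul, abs_mul, abs_pow, abs_of_nonneg (by positivity : (0 : ℝ) ≤ k + 1)]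
      simp; ring
    rw [e1, e3] at h
    have h2 := abs_floor_sub_floor_le (q * x) ((k + 1) * d)
    rw [abs_mul, abs_of_nonneg (by positivity : (0 : ℝ) ≤ k + 1)] at h2
    simp only [sub_sub_sub_cancel_right]
    refine h.trans ?_
    nlinarith
  have hmain := abs_sum_saw_sub_sawPrimitive_le (q * x) d hd0 k
  have hblocks : |∑ j ∈ Finset.range k, ∑ i ∈ Finset.range q,
        (Int.fract (x + (j * q + i : ℕ) * (p / q + ε : ℝ)) - 1 / 2) -
        ∑ j ∈ Finset.range k, (Int.fract (q * x + j * d) - 1 / 2)| ≤ 2 * (k * |d|) + 1 := by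
    rw [← Finset.sum_sub_distrib]
    refine (Finset.abs_sum_le_sum_abs _ _).trans ((Finset.sum_le_sum fun j _ => hblock j).trans ?_)
    rw [Finset.sum_add_distrib]
    have := sum_abs_floor_steps (q * x) d k
    simp only [Finset.sum_const, Finset.card_range, nsmul_eq_mul]
    linarith
  rw [sum_range_mul_add_eq]
  have h0 : 0 ≤ (k : ℝ) * |d| := by positivity
  rw [abs_le] at *
  constructor <;> linarith [hmain.1, hmain.2, hblocks.1, hblocks.2, hpart.1, hpart.2]

/-- A weighted count of the simultaneous small divisors `l`, `p * l` modulo `q`; it controls the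
quadratic fluctuations of Birkhoff sums along the rotation by `p / q`. -/
noncomputable def resonanceSum (q : ℕ) [NeZero q] (p : ZMod q) : ℝ :=
  ∑ l : ZMod q, ((q : ℝ) / (|(l.valMinAbs : ℝ)| * |((p * l).valMinAbs : ℝ)|)) ^ 2

lemma resonanceSum_nonneg (q : ℕ) [NeZero q] (p : ZMod q) : 0 ≤ resonanceSum q p :=
  Finset.sum_nonneg fun _ _ => sq_nonneg _

lemma norm_stdAddChar_sub_one (q : ℕ) [NeZero q] (j : ZMod q) :
    4 * |(j.valMinAbs : ℝ)| / q ≤ ‖ZMod.stdAddChar j - 1‖ := by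
  have hq : (0 : ℝ) < q := by exact_mod_cast Nat.pos_of_ne_zero (NeZero.ne q)
  have h1 : ZMod.stdAddChar j = Complex.exp (Complex.I * ((2 * Real.pi * j.valMinAbs / q : ℝ))) := by
    conv_lhs => rw [← ZMod.coe_valMinAbs j]
    rw [ZMod.stdAddChar_coe]
    congr 1
    push_cast
    ring
  rw [h1, Complex.norm_exp_I_mul_ofReal_sub_one, Real.norm_eq_abs, abs_mul, abs_two]
  have h2 : 2 * Real.pi * j.valMinAbs / q / 2 = Real.pi * j.valMinAbs / q := by ring
  rw [h2]
  have hb : |(j.valMinAbs : ℝ)| ≤ q / 2 := by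
    have := ZMod.natAbs_valMinAbs_le j
    have h3 : ((j.valMinAbs.natAbs : ℕ) : ℝ) ≤ ((q / 2 : ℕ) : ℝ) := by exact_mod_cast this
    rw [Nat.cast_natAbs] at h3
    push_cast at h3
    exact h3.trans Nat.cast_div_le
  have hpi := Real.pi_pos
  have h4 : |Real.pi * j.valMinAbs / q| = Real.pi * |(j.valMinAbs : ℝ)| / q := by
    rw [abs_div, abs_mul, abs_of_pos hpi, abs_of_pos hq]
  have h5 := Real.mul_abs_le_abs_sin (x := Real.pi * j.valMinAbs / q) (by
    rw [h4, div_le_div_iff₀ hq two_pos]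
    nlinarith)
  rw [h4] at h5
  have h6 : 2 / Real.pi * (Real.pi * |(j.valMinAbs : ℝ)| / q) = 2 * |(j.valMinAbs : ℝ)| / q := by
    field_simp
  rw [h6] at h5
  have : 4 * |(j.valMinAbs : ℝ)| / q = 2 * (2 * |(j.valMinAbs : ℝ)| / q) := by ring
  linarith

open ZMod in
lemma dft_comp_add_right (q : ℕ) [NeZero q] (Φ : ZMod q → ℂ) (a k : ZMod q) :
    𝓕 (fun j => Φ (j + a)) k = stdAddChar (a * k) * 𝓕 Φ k := by
  simp only [dft_apply, smul_eq_mul]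
  rw [Finset.mul_sum, ← Equiv.sum_comp (Equiv.addRight a)
    (fun j => stdAddChar (a * k) * (stdAddChar (-(j * k)) * Φ j))]
  refine Finset.sum_congr rfl fun j _ => ?_
  simp only [Equiv.coe_addRight]
  rw [← mul_assoc, ← AddChar.map_add_eq_mul]
  congr 2
  ring

open ZMod in
lemma sum_norm_sq_dft (q : ℕ) [NeZero q] (Φ : ZMod q → ℂ) :
    ∑ k, ‖𝓕 Φ k‖ ^ 2 = q * ∑ j, ‖Φ j‖ ^ 2 := by
  have h (z : ℂ) : ((‖z‖ ^ 2 : ℝ) : ℂ) = z * (starRingEnd ℂ) z := by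
    rw [Complex.mul_conj, Complex.normSq_eq_norm_sq]
  have key : ((∑ k, ‖𝓕 Φ k‖ ^ 2 : ℝ) : ℂ) = ((q * ∑ j, ‖Φ j‖ ^ 2 : ℝ) : ℂ) := by
    push_cast
    have h' (z : ℂ) : ((‖z‖ : ℂ) ^ 2) = z * (starRingEnd ℂ) z := by rw [← h]; push_cast; rfl
    simp_rw [h']
    have e1 (k : ZMod q) : 𝓕 Φ k * (starRingEnd ℂ) (𝓕 Φ k) =
        ∑ j, Φ j * (starRingEnd ℂ) (stdAddChar (j * k) * 𝓕 Φ k) := by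
      rw [dft_apply Φ k, Finset.sum_mul]
      refine Finset.sum_congr rfl fun j _ => ?_
      rw [map_mul, ← AddChar.map_neg_eq_conj, smul_eq_mul]
      ring
    simp_rw [e1]
    rw [Finset.sum_comm, Finset.mul_sum]
    refine Finset.sum_congr rfl fun j _ => ?_
    rw [← Finset.mul_sum, ← map_sum]
    have := congrFun (dft_dft Φ) (-j)
    rw [dft_apply] at this
    simp only [neg_neg, smul_eq_mul] at this
    have e2 : ∑ k, stdAddChar (j * k) * 𝓕 Φ k = q * Φ j := by
      rw [← this]
      refine Finset.sum_congr rfl fun k _ => ?_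
      congr 2
      ring
    rw [e2, map_mul, Complex.conj_natCast]
    ring
  exact_mod_cast key

open ZMod in
lemma exists_sum_sq_sub_le_resonanceSum (q : ℕ) [NeZero q] (p : ZMod q) (B : ZMod q → ℝ)
    (j₀ : ZMod q) (hB : ∀ z, B (z + 1 + p) - B (z + 1) - (B (z + p) - B z) =
      1 / q - if z = j₀ then 1 else 0) :
    ∃ C, ∑ z, (B z - C) ^ 2 ≤ q * resonanceSum q p := by
  have hq : (0 : ℝ) < q := by exact_mod_cast Nat.pos_of_ne_zero (NeZero.ne q)
  set C : ℝ := (∑ z, B z) / q with hC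
  refine ⟨C, ?_⟩
  let Φ : ZMod q → ℂ := fun z => ((B z - C : ℝ) : ℂ)
  have h0 : 𝓕 Φ 0 = 0 := by
    rw [dft_apply_zero]
    simp only [Φ]
    rw [← Complex.ofReal_sum, Finset.sum_sub_distrib]
    simp only [Finset.sum_const, Finset.card_univ, ZMod.card, nsmul_eq_mul, hC]
    rw [mul_div_cancel₀ _ hq.ne']
    simp
  have hk (k : ZMod q) (hk : k ≠ 0) : ‖stdAddChar (p * k) - 1‖ * ‖stdAddChar k - 1‖ * ‖𝓕 Φ k‖ = 1 := by
    have e : (fun z => Φ (z + (1 + p))) - (fun z => Φ (z + 1)) - ((fun z => Φ (z + p)) - Φ) =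
        fun z => (1 / q : ℂ) - if z = j₀ then 1 else 0 := by
      funext z
      have := hB z
      simp only [Pi.sub_apply, Φ, ← add_assoc]
      have h2 : ((B (z + 1 + p) - B (z + 1) - (B (z + p) - B z) : ℝ) : ℂ) =
        ((1 / q - if z = j₀ then 1 else 0 : ℝ) : ℂ) := by rw [this]
      split_ifs at h2 ⊢ <;> push_cast at h2 ⊢ <;> linear_combination h2
    have e2 := congrFun (congrArg 𝓕 e) k
    rw [map_sub, map_sub, map_sub] at e2
    simp only [Pi.sub_apply, dft_comp_add_right] at e2
    have e3 : 𝓕 (fun z : ZMod q => (1 / q : ℂ) - if z = j₀ then 1 else 0) k =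
        - stdAddChar (-(j₀ * k)) := by
      rw [dft_apply]
      simp only [smul_eq_mul, mul_sub, Finset.sum_sub_distrib, mul_ite, mul_one, mul_zero,
        Finset.sum_ite_eq', Finset.mem_univ, if_true]
      rw [← Finset.sum_mul]
      have : ∑ i : ZMod q, stdAddChar (-(i * k)) = 0 := by
        have h3 := AddChar.sum_mulShift (-k) (isPrimitive_stdAddChar q)
        rw [if_neg (neg_ne_zero.2 hk)] at h3
        rw [← Nat.cast_zero (R := ℂ), ← h3]
        refine Finset.sum_congr rfl fun i _ => ?_
        rw [mul_neg]
      rw [this]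
      simp
    rw [e3] at e2
    have e4 : (stdAddChar (p * k) - 1) * (stdAddChar k - 1) * 𝓕 Φ k =
        - stdAddChar (-(j₀ * k)) := by
      rw [← e2, add_mul, AddChar.map_add_eq_mul, one_mul]
      ring
    rw [← norm_mul, ← norm_mul, e4, norm_neg, AddChar.norm_apply]
  have hbound (k : ZMod q) : ‖𝓕 Φ k‖ ^ 2 ≤
      (q : ℝ) ^ 2 * ((q : ℝ) / (|(k.valMinAbs : ℝ)| * |((p * k).valMinAbs : ℝ)|)) ^ 2 := by
    by_cases hk0 : k = 0
    · rw [hk0, h0]; simp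
    rw [← mul_pow]
    refine pow_le_pow_left₀ (norm_nonneg _) ?_ 2
    have h1 := hk k hk0
    have a1 := norm_stdAddChar_sub_one q k
    have a2 := norm_stdAddChar_sub_one q (p * k)
    have n1 : p * k ≠ 0 := by
      intro h
      rw [h] at h1
      simp at h1
    have c1 : 0 < |(k.valMinAbs : ℝ)| := by
      rw [abs_pos]; exact_mod_cast (ZMod.valMinAbs_eq_zero k).not.2 hk0
    have c2 : 0 < |((p * k).valMinAbs : ℝ)| := by
      rw [abs_pos]; exact_mod_cast (ZMod.valMinAbs_eq_zero (p * k)).not.2 n1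
    set X := |(k.valMinAbs : ℝ)|
    set Y := |((p * k).valMinAbs : ℝ)|
    have h2 : (4 * Y / q) * (4 * X / q) * ‖𝓕 Φ k‖ ≤ 1 := by
      rw [← h1]
      gcongr
    have h3 : ‖𝓕 Φ k‖ ≤ 1 / ((4 * Y / q) * (4 * X / q)) := by
      rw [le_div_iff₀ (by positivity)]; linarith
    refine h3.trans ?_
    rw [div_le_iff₀ (by positivity)]
    have : (q : ℝ) * (q / (X * Y)) * (4 * Y / q * (4 * X / q)) = 16 := by field_simp; norm_num
    rw [this]
    norm_num
  have hP := sum_norm_sq_dft q Φ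
  have h1 : ∑ j, ‖Φ j‖ ^ 2 = ∑ z, (B z - C) ^ 2 := by
    refine Finset.sum_congr rfl fun z _ => ?_
    simp only [Φ, Complex.norm_real, Real.norm_eq_abs, sq_abs]
  have h2 : ∑ k, ‖𝓕 Φ k‖ ^ 2 ≤ (q : ℝ) ^ 2 * resonanceSum q p := by
    unfold resonanceSum
    rw [Finset.mul_sum]
    exact Finset.sum_le_sum fun k _ => hbound k
  rw [hP, h1, sq, mul_assoc] at h2
  exact le_of_mul_le_mul_left h2 hq

lemma exists_sum_sq_rationalSawSum_le (q : ℕ) [NeZero q] (p : ℤ) (hp : IsUnit (p : ZMod q))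
    (x : ℝ) : ∃ C, ∑ r ∈ Finset.range q, (rationalSawSum q p x r - C) ^ 2 ≤
      q * (2 * resonanceSum q (p : ZMod q) + 2) := by
  have hq : (0 : ℝ) < q := by exact_mod_cast Nat.pos_of_ne_zero (NeZero.ne q)
  obtain ⟨u, hu⟩ := hp
  set t := Int.fract (q * x) with ht
  have ht0 : 0 ≤ t := Int.fract_nonneg _
  have ht1 : t < 1 := Int.fract_lt_one _
  set m : ℝ := (t + (q - 1) / 2) / q with hm
  let b : ZMod q → ℝ := fun z => (z.val + t) / q - m
  set n₀ : ZMod q := (⌊q * x⌋ : ZMod q)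
  let A₀ : ℕ → ℝ := fun r => ∑ i ∈ Finset.range r, b (n₀ + p * i)
  have hsum : A₀ q = 0 := by
    have h := sum_fract_rational_orbit q p ⟨u, hu⟩ x
    simp_rw [fract_rational_orbit q p x] at h
    simp only [A₀, b]
    rw [Finset.sum_sub_distrib, h]
    simp only [Finset.sum_const, Finset.card_range, nsmul_eq_mul, hm]
    field_simp
    ring
  let A : ZMod q → ℝ := fun z => A₀ z.val
  have hA (z : ZMod q) : A (z + 1) - A z = b (n₀ + p * z) := by
    have hs : A₀ (z.val + 1) = A₀ z.val + b (n₀ + p * z) := by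
      simp only [A₀, Finset.sum_range_succ, ZMod.natCast_zmod_val]
    have hc : ((z.val + 1 : ℕ) : ZMod q) = z + 1 := by simp
    have : A (z + 1) = A₀ (z.val + 1) := by
      simp only [A]
      rcases Nat.lt_or_ge (z.val + 1) q with h | h
      · rw [← hc, ZMod.val_cast_of_lt h]
      · have h2 : z.val + 1 = q := le_antisymm (ZMod.val_lt z) h
        rw [← hc, h2, hsum]
        simp [A₀]
    rw [this, hs]
    simp [A]
  let B : ZMod q → ℝ := fun z => A (u⁻¹ * z)
  have hBp (z : ZMod q) : B (z + p) - B z = b (n₀ + z) := by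
    have h := hA (u⁻¹ * z)
    have e1 : (u⁻¹ : (ZMod q)ˣ) * (z + p) = u⁻¹ * z + 1 := by
      rw [mul_add, ← hu, Units.inv_mul]
    have e2 : (p : ZMod q) * (u⁻¹ * z) = z := by rw [← hu, Units.mul_inv_cancel_left]
    simp only [B]
    rw [e1, h, e2]
  have hb (z : ZMod q) : b (z + 1) - b z = 1 / q - if z = -1 then 1 else 0 := by
    have hc : ((z.val + 1 : ℕ) : ZMod q) = z + 1 := by simp
    simp only [b]
    by_cases h : z = -1
    · have h1 : z + 1 = 0 := by rw [h]; ring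
      have h2 : z.val + 1 = q := by
        rcases Nat.lt_or_ge (z.val + 1) q with h3 | h3
        · have := ZMod.val_cast_of_lt h3
          rw [hc, h1] at this
          simp at this
        · exact le_antisymm (ZMod.val_lt z) h3
      have h3 : (z.val : ℝ) = q - 1 := by rw [eq_sub_iff_add_eq]; exact_mod_cast h2
      rw [h1, if_pos h, h3]
      simp only [ZMod.val_zero, Nat.cast_zero]
      field_simp
      ring
    · have h2 : z.val + 1 < q := by
        refine lt_of_le_of_ne (ZMod.val_lt z) fun h3 => h ?_
        rw [h3, ZMod.natCast_self] at hc
        exact eq_neg_of_add_eq_zero_left hc.symm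
      rw [← hc, ZMod.val_cast_of_lt h2, if_neg h]
      push_cast
      field_simp
      ring
  obtain ⟨C, hC⟩ := exists_sum_sq_sub_le_resonanceSum q (p : ZMod q) B (-1 - n₀) (fun z => by
    have h1 := hBp (z + 1)
    have h2 := hBp z
    have h3 := hb (n₀ + z)
    have h4 : (n₀ + z = -1) = (z = -1 - n₀) := by
      rw [eq_sub_iff_add_eq, add_comm]
    simp only [h4] at h3
    rw [← h3, h1, h2, add_assoc])
  refine ⟨C, ?_⟩
  have hsumA : ∑ r ∈ Finset.range q, (A₀ r - C) ^ 2 = ∑ z, (B z - C) ^ 2 := by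
    have e1 : ∑ z, (B z - C) ^ 2 = ∑ z, (A z - C) ^ 2 :=
      Equiv.sum_comp (Units.mulLeft u⁻¹) (fun z => (A z - C) ^ 2)
    rw [e1, ← sum_range_zmod]
    refine Finset.sum_congr rfl fun r hr => ?_
    simp only [A]
    rw [ZMod.val_cast_of_lt (Finset.mem_range.1 hr)]
  have hterm (r : ℕ) (hr : r ∈ Finset.range q) :
      (rationalSawSum q p x r - C) ^ 2 ≤ 2 * (A₀ r - C) ^ 2 + 2 := by
    have e : rationalSawSum q p x r = A₀ r + r * (m - 1 / 2) := by
      unfold rationalSawSum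
      simp_rw [fract_rational_orbit q p x]
      simp only [A₀, b]
      rw [Finset.sum_sub_distrib, Finset.sum_sub_distrib]
      simp only [Finset.sum_const, Finset.card_range, nsmul_eq_mul]
      ring
    have hr' : (r : ℝ) ≤ q := by exact_mod_cast (Finset.mem_range.1 hr).le
    have h1 : |r * (m - 1 / 2)| ≤ 1 := by
      have : m - 1 / 2 = (t - 1 / 2) / q := by rw [hm]; field_simp; ring
      rw [this, abs_mul, abs_div, Nat.abs_cast, Nat.abs_cast, ← mul_div_assoc, div_le_one hq]
      have : |t - 1 / 2| ≤ 1 := by rw [abs_le]; constructor <;> linarith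
      nlinarith [abs_nonneg (t - 1 / 2)]
    have h2 : (r * (m - 1 / 2)) ^ 2 ≤ 1 := by
      rw [← sq_abs]; nlinarith [abs_nonneg (r * (m - 1 / 2))]
    rw [e]
    nlinarith [sq_nonneg (A₀ r - C - r * (m - 1 / 2))]
  calc _ ≤ ∑ r ∈ Finset.range q, (2 * (A₀ r - C) ^ 2 + 2) := Finset.sum_le_sum hterm
    _ = 2 * ∑ z, (B z - C) ^ 2 + 2 * q := by
      rw [Finset.sum_add_distrib, ← Finset.mul_sum, hsumA]; simp; ring
    _ ≤ _ := by nlinarith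

lemma sum_natAbs_le_two_mul_sum {ι : Type*} (S : Finset ι) (v : ι → ℤ) (hinj : Set.InjOn v S)
    (hv0 : ∀ i ∈ S, v i ≠ 0) (n : ℕ) (hvn : ∀ i ∈ S, (v i).natAbs ≤ n) (h : ℕ → ℝ)
    (h0 : ∀ k, 0 ≤ h k) :
    ∑ i ∈ S, h (v i).natAbs ≤ 2 * ∑ k ∈ Finset.Icc 1 n, h k := by
  classical
  rw [← Finset.sum_fiberwise_of_maps_to (s := S) (t := Finset.Icc 1 n)
    (g := fun i => (v i).natAbs)
    (fun i hi => Finset.mem_Icc.2 ⟨Nat.pos_of_ne_zero (Int.natAbs_ne_zero.2 (hv0 i hi)),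
      hvn i hi⟩), Finset.mul_sum]
  refine Finset.sum_le_sum fun k _ => ?_
  rw [Finset.sum_congr rfl (g := fun _ => h k)
    (fun i hi => by rw [(Finset.mem_filter.1 hi).2]), Finset.sum_const, nsmul_eq_mul]
  refine mul_le_mul_of_nonneg_right ?_ (h0 k)
  have : (S.filter fun i => (v i).natAbs = k).card ≤ ({(k : ℤ), -(k : ℤ)} : Finset ℤ).card := by
    refine Finset.card_le_card_of_injOn v (fun i hi => ?_)
      (hinj.mono (by intro i hi; exact (Finset.mem_filter.1 hi).1))
    have := (Finset.mem_filter.1 hi).2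
    simp only [Finset.coe_insert, Finset.coe_singleton, Set.mem_insert_iff, Set.mem_singleton_iff]
    omega
  exact_mod_cast this.trans Finset.card_le_two

lemma sum_min_one_sq_div_le (y : ℝ) (hy : 0 ≤ y) (n : ℕ) :
    ∑ k ∈ Finset.Icc 1 n, min 1 ((y / k) ^ 2) ≤ 4 * y := by
  rcases hy.eq_or_lt with rfl | hy
  · simp
  have key : ∑ k ∈ Finset.Icc 1 n, min 1 ((y / k) ^ 2) ≤ 4 * y ^ 2 * (1 / y - 1 / (y + n)) := by
    induction n with
    | zero => simp
    | succ n ih =>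
      rw [Finset.sum_Icc_succ_top (by omega)]
      have : min 1 ((y / (n + 1 : ℕ)) ^ 2) ≤
          4 * y ^ 2 * (1 / (y + n) - 1 / (y + (n + 1 : ℕ))) := by
        push_cast
        have hn : (0 : ℝ) ≤ n := Nat.cast_nonneg n
        have e : 4 * y ^ 2 * (1 / (y + n) - 1 / (y + (n + 1))) =
            4 * y ^ 2 / ((y + n) * (y + (n + 1))) := by
          field_simp; ring
        rw [e, le_div_iff₀ (by positivity)]
        rcases le_total (n + 1 : ℝ) y with h | h
        · have := min_le_left 1 ((y / (n + 1 : ℝ)) ^ 2)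
          nlinarith [mul_nonneg hn hn, mul_pos hy hy,
            mul_le_mul_of_nonneg_right this (by positivity : 0 ≤ (y + n) * (y + (n + 1)))]
        · have := min_le_right 1 ((y / (n + 1 : ℝ)) ^ 2)
          refine (mul_le_mul_of_nonneg_right this (by positivity)).trans ?_
          rw [div_pow, div_mul_eq_mul_div, div_le_iff₀ (by positivity)]
          have : (y + n) * (y + (n + 1)) ≤ 4 * (n + 1 : ℝ) ^ 2 := by nlinarith
          nlinarith [mul_le_mul_of_nonneg_left this (sq_nonneg y)]
      linarith
  refine key.trans ?_
  have : 4 * y ^ 2 * (1 / y - 1 / (y + n)) = 4 * y - 4 * y ^ 2 / (y + n) := by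
    field_simp
  rw [this]
  have : 0 ≤ 4 * y ^ 2 / (y + n) := by positivity
  linarith

/-- Weighted sums over the nonzero values of a homomorphism from a finite group to the circle are
controlled by the corresponding sums over the multiples of `1 / L`. -/
lemma sum_norm_addMonoidHom_le {A : Type*} [AddCommGroup A] [Fintype A] (f : A →+ UnitAddCircle)
    (h : ℝ → ℝ) (h0 : ∀ t, 0 ≤ h t) (c : ℝ)
    (hc : ∀ L n : ℕ, 0 < L → ∑ k ∈ Finset.Icc 1 n, h (k / L) ≤ c * L) :
    ∑ a : A with f a ≠ 0, h ‖f a‖ ≤ 2 * c * Fintype.card A := by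
  classical
  set I : Finset UnitAddCircle := Finset.univ.image f with hI
  set L := I.card
  set g := (Finset.univ.filter fun a => f a = 0).card with hg
  have hfib (x : UnitAddCircle) (hx : x ∈ I) : (Finset.univ.filter fun a => f a = x).card = g := by
    obtain ⟨a, -, rfl⟩ := Finset.mem_image.1 hx
    refine Finset.card_bij (fun b _ => b - a) (fun b hb => ?_) (fun b _ c _ h => by simpa using h)
      (fun b hb => ⟨b + a, ?_, by simp⟩)
    · simp only [Finset.mem_filter, Finset.mem_univ, true_and] at hb ⊢
      rw [map_sub, hb, sub_self]
    · simp only [Finset.mem_filter, Finset.mem_univ, true_and] at hb ⊢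
      rw [map_add, hb, zero_add]
  have hgL : L * g = Fintype.card A := by
    rw [← Finset.card_univ, Finset.card_eq_sum_card_fiberwise (f := f) (t := I)
      (fun a _ => Finset.mem_coe.2 (Finset.mem_image_of_mem _ (Finset.mem_univ a))),
      Finset.sum_congr rfl hfib, Finset.sum_const, smul_eq_mul]
  have hLpos : 0 < L := Finset.card_pos.2 ⟨f 0, Finset.mem_image_of_mem _ (Finset.mem_univ _)⟩
  have hLR : (0 : ℝ) < L := by exact_mod_cast hLpos
  have htors (x : UnitAddCircle) (hx : x ∈ I) : L • x = 0 := by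
    obtain ⟨a, -, rfl⟩ := Finset.mem_image.1 hx
    have hcard : Nat.card f.range = L := by
      rw [← SetLike.coe_sort_coe, Nat.card_coe_set_eq, AddMonoidHom.coe_range,
        show L = I.card from rfl, ← Set.ncard_coe_finset]
      congr 1
      simp [hI]
    have : L • (⟨f a, a, rfl⟩ : f.range) = 0 := by
      rw [← hcard]; exact card_nsmul_eq_zero'
    exact congrArg Subtype.val this
  have hrep (x : UnitAddCircle) (hx : L • x = 0) : ∃ k : ℤ, x = ((k / L : ℝ) : UnitAddCircle) ∧
      ‖x‖ = (k.natAbs : ℝ) / L := by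
    obtain ⟨t, rfl⟩ := QuotientAddGroup.mk_surjective x
    have h1 : ((L • t : ℝ) : UnitAddCircle) = 0 := hx
    obtain ⟨m, hm⟩ := (AddCircle.coe_eq_zero_iff (1 : ℝ)).1 h1
    simp only [zsmul_eq_mul, mul_one, nsmul_eq_mul] at hm
    have ht : t = m / L := by rw [hm]; field_simp
    refine ⟨m - round t * L, ?_, ?_⟩
    · have : ((m - round t * L : ℤ) : ℝ) / L = t - round t := by
        push_cast; rw [hm]; field_simp
      rw [this, AddCircle.coe_sub]
      have : ((round t : ℝ) : UnitAddCircle) = 0 :=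
        (AddCircle.coe_eq_zero_iff (1 : ℝ)).2 ⟨round t, by simp⟩
      rw [this, sub_zero]
    · have h2 : ‖((t : ℝ) : UnitAddCircle)‖ = |t - round t| := UnitAddCircle.norm_eq
      refine h2.trans ?_
      rw [Nat.cast_natAbs, Int.cast_abs, show ∀ z : ℝ, |z| / L = |z / L| from fun z => by rw [abs_div, abs_of_pos hLR]]
      congr 1
      push_cast; rw [hm]; field_simp
  choose! v hv1 hv2 using hrep
  have hsum : ∑ x ∈ I with x ≠ 0, h ‖x‖ ≤ 2 * (c * L) := by
    have e := sum_natAbs_le_two_mul_sum (I.filter fun x => x ≠ 0) v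
      (fun x hx y hy hxy => by
        have hx := htors x (Finset.mem_filter.1 hx).1
        have hy := htors y (Finset.mem_filter.1 hy).1
        rw [hv1 x hx, hv1 y hy, hxy])
      (fun x hx hvx => by
        have h1 := Finset.mem_filter.1 hx
        apply h1.2
        rw [hv1 x (htors x h1.1), hvx]; simp)
      ((I.filter fun x => x ≠ 0).sup fun x => (v x).natAbs)
      (fun x hx => Finset.le_sup (f := fun x => (v x).natAbs) hx)
      (fun k => h (k / L)) (fun k => h0 _)
    refine le_trans (le_of_eq (Finset.sum_congr rfl fun x hx => ?_))
      (e.trans (mul_le_mul_of_nonneg_left (hc L _ hLpos) (by norm_num)))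
    rw [hv2 x (htors x (Finset.mem_filter.1 hx).1)]
  have hsplit : ∑ a : A with f a ≠ 0, h ‖f a‖ = g * ∑ x ∈ I with x ≠ 0, h ‖x‖ := by
    rw [← Finset.sum_fiberwise_of_maps_to (s := Finset.univ.filter fun a => f a ≠ 0)
      (t := I.filter fun x => x ≠ 0) (g := f)
      (fun a ha => Finset.mem_filter.2 ⟨Finset.mem_image_of_mem _ (Finset.mem_univ a),
        (Finset.mem_filter.1 ha).2⟩), Finset.mul_sum]
    refine Finset.sum_congr rfl fun x hx => ?_
    have hx' := Finset.mem_filter.1 hx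
    rw [Finset.sum_congr rfl (g := fun _ => h ‖x‖)
      (fun i hi => by rw [(Finset.mem_filter.1 hi).2]), Finset.sum_const, nsmul_eq_mul,
      ← hfib x hx'.1, Finset.filter_filter]
    congr 3
    ext a
    simp only [Finset.mem_filter, Finset.mem_univ, true_and, and_iff_right_iff_imp]
    rintro rfl
    exact hx'.2
  rw [hsplit]
  calc (g : ℝ) * ∑ x ∈ I with x ≠ 0, h ‖x‖ ≤ g * (2 * (c * L)) :=
        mul_le_mul_of_nonneg_left hsum (Nat.cast_nonneg g)
    _ = 2 * c * Fintype.card A := by rw [← hgL]; push_cast; ring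

lemma norm_toAddCircle_eq (q : ℕ) [NeZero q] (z : ZMod q) :
    ‖ZMod.toAddCircle z‖ = |(z.valMinAbs : ℝ)| / q := by
  have hq : (0 : ℝ) < q := by exact_mod_cast Nat.pos_of_ne_zero (NeZero.ne q)
  conv_lhs => rw [← ZMod.coe_valMinAbs z, ZMod.toAddCircle_intCast]
  rw [(AddCircle.norm_coe_eq_abs_iff (1 : ℝ) one_ne_zero).2]
  · rw [abs_div, abs_of_pos hq]
  · rw [abs_div, abs_of_pos hq, abs_one, div_le_iff₀ hq]
    have h : z.valMinAbs.natAbs * 2 ≤ q := by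
      have := ZMod.natAbs_valMinAbs_le z
      omega
    have h2 : |(z.valMinAbs : ℝ)| * 2 ≤ q := by
      rw [← Int.cast_abs, Int.abs_eq_natAbs]
      exact_mod_cast h
    linarith

lemma sum_one_div_valMinAbs_le (q : ℕ) [NeZero q] :
    ∑ l : ZMod q with l ≠ 0, 1 / |(l.valMinAbs : ℝ)| ≤ 2 * ∑ i ∈ Finset.range q, 1 / (i + 1 : ℝ) := by
  have h := sum_natAbs_le_two_mul_sum (Finset.univ.filter fun l : ZMod q => l ≠ 0)
    ZMod.valMinAbs ZMod.injective_valMinAbs.injOn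
    (fun l hl => (ZMod.valMinAbs_eq_zero l).not.2 (Finset.mem_filter.1 hl).2) q
    (fun l _ => (ZMod.natAbs_valMinAbs_le l).trans (Nat.div_le_self q 2))
    (fun k => 1 / (k : ℝ)) (fun k => by positivity)
  have e : ∑ i ∈ Finset.range q, 1 / (i + 1 : ℝ) = ∑ k ∈ Finset.Icc 1 q, 1 / (k : ℝ) := by
    rw [Finset.range_eq_Ico]
    have := Finset.sum_Ico_add' (fun i : ℕ => 1 / (i : ℝ)) 0 q 1
    push_cast at this
    rw [this]
    rfl
  rw [e]
  refine le_trans (le_of_eq (Finset.sum_congr rfl fun l _ => ?_)) h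
  rw [Nat.cast_natAbs, Int.cast_abs]

lemma sum_min_resonance_le (q : ℕ) [NeZero q] (l : ZMod q) (y : ℝ) (hy : 0 ≤ y) :
    ∑ p : ZMod q with p * l ≠ 0, min 1 ((y / |((p * l).valMinAbs : ℝ)|) ^ 2) ≤ 8 * y := by
  have hq : (0 : ℝ) < q := by exact_mod_cast Nat.pos_of_ne_zero (NeZero.ne q)
  have h := sum_norm_addMonoidHom_le
    ((ZMod.toAddCircle (N := q)).comp (AddMonoidHom.mulRight l))
    (fun t => min 1 ((y / q / t) ^ 2)) (fun t => by positivity) (4 * (y / q)) (fun L n hL => by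
      have hL' : (0 : ℝ) < L := by exact_mod_cast hL
      have := sum_min_one_sq_div_le (y / q * L) (by positivity) n
      refine le_trans (le_of_eq (Finset.sum_congr rfl fun k _ => ?_)) (this.trans (by linarith))
      congr 2
      rw [div_div_eq_mul_div])
  rw [ZMod.card] at h
  have e : 2 * (4 * (y / q)) * q = 8 * y := by field_simp; ring
  rw [e] at h
  refine le_trans (le_of_eq ?_) h
  refine Finset.sum_congr ?_ fun p _ => ?_
  · ext p
    simp [ZMod.toAddCircle_eq_zero]
  · simp only [AddMonoidHom.coe_comp, Function.comp_apply, AddMonoidHom.coe_mulRight]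
    rw [norm_toAddCircle_eq]
    congr 2
    field_simp

lemma card_resonanceSum_gt_le (q : ℕ) [NeZero q] (s : ℝ) (hs : 0 < s) :
    (Finset.card {p : ZMod q | IsUnit p ∧ s ^ 2 < resonanceSum q p} : ℝ) ≤
      16 * q / s * ∑ i ∈ Finset.range q, 1 / (i + 1 : ℝ) := by
  classical
  have hq : (0 : ℝ) < q := by exact_mod_cast Nat.pos_of_ne_zero (NeZero.ne q)
  let m : ZMod q → ZMod q → ℝ := fun l p =>
    min 1 ((q / (|(l.valMinAbs : ℝ)| * s) / |((p * l).valMinAbs : ℝ)|) ^ 2)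
  have hm0 (l p) : 0 ≤ m l p := by positivity
  have h1 (p : ZMod q) (hp : IsUnit p ∧ s ^ 2 < resonanceSum q p) :
      1 ≤ ∑ l : ZMod q with l ≠ 0 ∧ p * l ≠ 0, m l p := by
    obtain ⟨hu, hW⟩ := hp
    by_cases hex : ∃ l ∈ Finset.univ.filter fun l : ZMod q => l ≠ 0 ∧ p * l ≠ 0, m l p = 1
    · obtain ⟨l, hl, hl1⟩ := hex
      rw [← hl1]
      exact Finset.single_le_sum (f := fun l => m l p) (fun i _ => hm0 i p) hl
    · push Not at hex
      have e : ∑ l : ZMod q with l ≠ 0 ∧ p * l ≠ 0, m l p = resonanceSum q p / s ^ 2 := by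
        unfold resonanceSum
        rw [Finset.sum_div, Finset.sum_filter]
        refine Finset.sum_congr rfl fun l _ => ?_
        split_ifs with hl
        · have := hex l (Finset.mem_filter.2 ⟨Finset.mem_univ _, hl⟩)
          have h2 : m l p = (q / (|(l.valMinAbs : ℝ)| * s) / |((p * l).valMinAbs : ℝ)|) ^ 2 := by
            rcases min_choice 1 ((q / (|(l.valMinAbs : ℝ)| * s) / |((p * l).valMinAbs : ℝ)|) ^ 2)
              with h | h
            · exact absurd h this
            · exact h
          rw [h2, ← div_pow]
          congr 1
          rw [div_div, div_div]
          congr 1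
          ring
        · have : l = 0 := by
            by_contra h
            apply hl
            exact ⟨h, fun h' => h ((hu.mul_right_eq_zero).1 h')⟩
          subst this
          simp
      rw [e, le_div_iff₀ (by positivity)]
      linarith
  calc (Finset.card {p : ZMod q | IsUnit p ∧ s ^ 2 < resonanceSum q p} : ℝ)
      = ∑ p : ZMod q with IsUnit p ∧ s ^ 2 < resonanceSum q p, (1 : ℝ) := by simp
    _ ≤ ∑ p : ZMod q with IsUnit p ∧ s ^ 2 < resonanceSum q p,
          ∑ l : ZMod q with l ≠ 0 ∧ p * l ≠ 0, m l p :=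
        Finset.sum_le_sum fun p hp => h1 p (Finset.mem_filter.1 hp).2
    _ ≤ ∑ p : ZMod q, ∑ l : ZMod q with l ≠ 0 ∧ p * l ≠ 0, m l p :=
        Finset.sum_le_sum_of_subset_of_nonneg (Finset.subset_univ _)
          fun p _ _ => Finset.sum_nonneg fun l _ => hm0 l p
    _ = ∑ l : ZMod q with l ≠ 0, ∑ p : ZMod q with p * l ≠ 0, m l p := by
        simp only [Finset.sum_filter]
        rw [Finset.sum_comm]
        refine Finset.sum_congr rfl fun l _ => ?_
        by_cases hl : l = 0 <;> simp [hl]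
    _ ≤ ∑ l : ZMod q with l ≠ 0, 8 * (q / (|(l.valMinAbs : ℝ)| * s)) :=
        Finset.sum_le_sum fun l _ => sum_min_resonance_le q l _ (by positivity)
    _ = 8 * q / s * ∑ l : ZMod q with l ≠ 0, 1 / |(l.valMinAbs : ℝ)| := by
        rw [Finset.mul_sum]
        refine Finset.sum_congr rfl fun l _ => ?_
        rw [div_mul_div_comm, mul_one, mul_div_assoc, mul_comm s]
    _ ≤ 8 * q / s * (2 * ∑ i ∈ Finset.range q, 1 / (i + 1 : ℝ)) :=
        mul_le_mul_of_nonneg_left (sum_one_div_valMinAbs_le q) (by positivity)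
    _ = _ := by ring

lemma tendsto_sum_range_atTop_of_not_summable {b : ℕ → ℝ} (hb : ∀ n, 0 ≤ b n)
    (h : ¬ Summable b) : Tendsto (fun n => ∑ i ∈ Finset.range n, b i) atTop atTop :=
  (not_summable_iff_tendsto_nat_atTop_of_nonneg hb).1 h

/-- The Abel–Dini theorem, divergent part. -/
lemma not_summable_div_partialSum {b : ℕ → ℝ} (hb : ∀ n, 0 < b n) (h : ¬ Summable b) :
    ¬ Summable fun n => b n / ∑ i ∈ Finset.range (n + 1), b i := by
  intro hs
  have hT := tendsto_sum_range_atTop_of_not_summable (fun n => (hb n).le) h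
  set S : ℕ → ℝ := fun n => ∑ i ∈ Finset.range n, b i with hS
  have hpos (n : ℕ) : 0 < S (n + 1) :=
    Finset.sum_pos (fun i _ => hb i) (by simp)
  have hc := summable_iff_cauchySeq_finset.1 hs
  obtain ⟨s, hs'⟩ := cauchySeq_finset_iff_vanishing_norm.1 hc (1 / 2) (by norm_num)
  obtain ⟨m, hm⟩ := s.exists_nat_subset_range
  obtain ⟨n, hn⟩ := ((hT.eventually_ge_atTop (2 * S m + 1)).and (eventually_gt_atTop m)).exists
  obtain ⟨hn1, hn2⟩ := hn
  have h1 := hs' (Finset.Ico m n) (by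
    rw [Finset.disjoint_left]
    intro i hi hi'
    have := Finset.mem_range.1 (hm hi')
    have := (Finset.mem_Ico.1 hi).1
    omega)
  have hSn : 0 < S n := by
    obtain ⟨k, rfl⟩ := Nat.exists_eq_succ_of_ne_zero (by omega : n ≠ 0)
    exact hpos k
  have h2 : (S n - S m) / S n ≤ ∑ i ∈ Finset.Ico m n, b i / S (i + 1) := by
    have : S n - S m = ∑ i ∈ Finset.Ico m n, b i := by
      rw [Finset.sum_Ico_eq_sub _ hn2.le]
    rw [this, Finset.sum_div]
    refine Finset.sum_le_sum fun i hi => ?_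
    refine div_le_div_of_nonneg_left (hb i).le (hpos i) ?_
    exact Finset.sum_le_sum_of_subset_of_nonneg
      (Finset.range_mono (by have := (Finset.mem_Ico.1 hi).2; omega)) fun j _ _ => (hb j).le
  have h3 := (le_abs_self _).trans_lt h1
  have h4 : (1 : ℝ) / 2 ≤ (S n - S m) / S n := by
    rw [div_le_div_iff₀ (by norm_num) hSn]
    linarith
  linarith

/-- The Abel–Dini theorem, convergent part. -/
lemma summable_div_partialSum_sq {b : ℕ → ℝ} (hb : ∀ n, 0 < b n) :
    Summable fun n => b n / (∑ i ∈ Finset.range (n + 1), b i) ^ 2 := by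
  set S : ℕ → ℝ := fun n => ∑ i ∈ Finset.range n, b i with hS
  have hpos (n : ℕ) : 0 < S (n + 1) :=
    Finset.sum_pos (fun i _ => hb i) (by simp)
  refine summable_of_sum_range_le (c := 2 / b 0) (fun n => (div_pos (hb n) (pow_pos (hpos n) 2)).le)
    fun n => ?_
  have key (n : ℕ) : ∑ i ∈ Finset.range (n + 1), b i / S (i + 1) ^ 2 ≤ 2 / b 0 - 1 / S (n + 1) := by
    induction n with
    | zero =>
      have := (hb 0).ne'
      simp only [hS, zero_add, Finset.sum_range_one]
      apply le_of_eq
      field_simp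
      norm_num
    | succ n ih =>
      rw [Finset.sum_range_succ]
      have h1 : S (n + 1 + 1) = S (n + 1) + b (n + 1) := Finset.sum_range_succ _ _
      have : b (n + 1) / S (n + 1 + 1) ^ 2 ≤ 1 / S (n + 1) - 1 / S (n + 1 + 1) := by
        rw [div_sub_div _ _ (hpos n).ne' (hpos (n + 1)).ne', div_le_div_iff₀
          (pow_pos (hpos _) 2) (mul_pos (hpos _) (hpos _))]
        have e : 1 * S (n + 1 + 1) - S (n + 1) * 1 = b (n + 1) := by rw [h1]; ring
        rw [e]
        refine mul_le_mul_of_nonneg_left ?_ (hb _).le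
        rw [sq]
        refine mul_le_mul_of_nonneg_right ?_ (hpos _).le
        rw [h1]; linarith [hb (n + 1)]
      linarith
  rcases n with _ | n
  · simp only [Finset.range_zero, Finset.sum_empty]
    have := hb 0
    positivity
  · have h1 : 0 < 1 / S (n + 1) := div_pos one_pos (hpos n)
    linarith [key n]

/-- Abel summation: domination of partial sums is preserved by antitone weights. -/
lemma sum_mul_le_sum_mul_of_antitone (a b w : ℕ → ℝ) (hw : Antitone w) (hw0 : ∀ n, 0 ≤ w n)
    (h : ∀ n, ∑ i ∈ Finset.range n, b i ≤ ∑ i ∈ Finset.range n, a i) (n : ℕ) :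
    ∑ i ∈ Finset.range n, b i * w i ≤ ∑ i ∈ Finset.range n, a i * w i := by
  have key : w n * ∑ i ∈ Finset.range n, (a i - b i) ≤
      ∑ i ∈ Finset.range n, (a i - b i) * w i := by
    induction n with
    | zero => simp
    | succ n ih =>
      rw [Finset.sum_range_succ (fun i => (a i - b i) * w i)]
      have h1 : 0 ≤ ∑ i ∈ Finset.range (n + 1), (a i - b i) := by
        rw [Finset.sum_sub_distrib]; linarith [h (n + 1)]
      have h2 := mul_le_mul_of_nonneg_right (hw (Nat.le_succ n)) h1
      rw [Finset.sum_range_succ] at h2 ⊢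
      simp only [Nat.succ_eq_add_one] at h2
      linarith
  have h1 : 0 ≤ ∑ i ∈ Finset.range n, (a i - b i) := by
    rw [Finset.sum_sub_distrib]; linarith [h n]
  have h2 := (mul_nonneg (hw0 n) h1).trans key
  simp only [sub_mul, Finset.sum_sub_distrib] at h2
  linarith

lemma half_mul_le_sum_totient_div (n : ℕ) :
    ∑ _i ∈ Finset.range n, (1 / 2 : ℝ) ≤ ∑ i ∈ Finset.range n, (Nat.totient (i + 1) : ℝ) / (i + 1) := by
  rcases Nat.eq_zero_or_pos n with rfl | hn
  · simp
  have hnR : (0 : ℝ) < n := by exact_mod_cast hn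
  have h1 : ∑ m ∈ Finset.Icc 1 n, m = ∑ d ∈ Finset.Icc 1 n, Nat.totient d * (n / d) := by
    calc ∑ m ∈ Finset.Icc 1 n, m = ∑ m ∈ Finset.Icc 1 n, ∑ d ∈ Finset.Icc 1 n with d ∣ m,
          Nat.totient d := by
          refine Finset.sum_congr rfl fun m hm => ?_
          conv_lhs => rw [← Nat.sum_totient m]
          refine Finset.sum_congr ?_ fun _ _ => rfl
          ext d
          have hm' := Finset.mem_Icc.1 hm
          simp only [Nat.mem_divisors, Finset.mem_filter, Finset.mem_Icc]
          constructor
          · rintro ⟨h, h'⟩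
            exact ⟨⟨Nat.pos_of_dvd_of_pos h (by omega), (Nat.le_of_dvd (by omega) h).trans hm'.2⟩, h⟩
          · rintro ⟨-, h⟩
            exact ⟨h, by omega⟩
      _ = ∑ d ∈ Finset.Icc 1 n, Nat.totient d * (n / d) := by
          simp only [Finset.sum_filter]
          rw [Finset.sum_comm]
          refine Finset.sum_congr rfl fun d _ => ?_
          rw [← Finset.sum_filter, Finset.sum_const, smul_eq_mul, mul_comm]
          congr 1
          exact Nat.Ioc_filter_dvd_card_eq_div n d
  have h2 : ((∑ m ∈ Finset.Icc 1 n, m : ℕ) : ℝ) = n * (n + 1) / 2 := by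
    have : ∀ k : ℕ, ((∑ m ∈ Finset.Icc 1 k, m : ℕ) : ℝ) = k * (k + 1) / 2 := by
      intro k
      induction k with
      | zero => simp
      | succ k ih =>
        rw [Finset.sum_Icc_succ_top (by omega), Nat.cast_add, ih]
        push_cast; ring
    exact this n
  have h3 : (n : ℝ) * (n + 1) / 2 ≤
      n * ∑ i ∈ Finset.range n, (Nat.totient (i + 1) : ℝ) / (i + 1) := by
    rw [← h2, h1, Nat.cast_sum]
    have e : ∑ i ∈ Finset.range n, (Nat.totient (i + 1) : ℝ) / (i + 1) =
        ∑ d ∈ Finset.Icc 1 n, (Nat.totient d : ℝ) / d := by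
      rw [Finset.range_eq_Ico]
      have := Finset.sum_Ico_add' (fun i : ℕ => (Nat.totient i : ℝ) / (i : ℝ)) 0 n 1
      push_cast at this
      rw [this]
      rfl
    rw [e, Finset.mul_sum]
    refine Finset.sum_le_sum fun d _ => ?_
    push_cast
    have := @Nat.cast_div_le ℝ _ _ _ n d
    calc (Nat.totient d : ℝ) * ((n / d : ℕ) : ℝ) ≤ Nat.totient d * (n / d) :=
          mul_le_mul_of_nonneg_left this (Nat.cast_nonneg _)
      _ = _ := by ring
  rw [Finset.sum_const, Finset.card_range, nsmul_eq_mul]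
  refine le_of_mul_le_mul_left ?_ hnR
  nlinarith

lemma sum_measureReal_le_union {Ω ι : Type*} [MeasurableSpace Ω] (μ : Measure Ω)
    [IsProbabilityMeasure μ] (s : Finset ι) (E : ι → Set Ω) (hE : ∀ i, MeasurableSet (E i))
    (c : ℝ) (hc : 0 < c) :
    ∑ i ∈ s, μ.real (E i) ≤ 1 / (2 * c) * ∑ i ∈ s, ∑ j ∈ s, μ.real (E i ∩ E j) +
      c / 2 * μ.real (⋃ i ∈ s, E i) := by
  classical
  set U : Set Ω := ⋃ i ∈ s, E i with hU
  have hUm : MeasurableSet U := Finset.measurableSet_biUnion s fun i _ => hE i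
  have hpt (x : Ω) : ∑ i ∈ s, (E i).indicator (1 : Ω → ℝ) x ≤
      1 / (2 * c) * ∑ i ∈ s, ∑ j ∈ s, (E i ∩ E j).indicator (1 : Ω → ℝ) x +
        c / 2 * U.indicator (1 : Ω → ℝ) x := by
    have hsq : ∑ i ∈ s, ∑ j ∈ s, (E i ∩ E j).indicator (1 : Ω → ℝ) x =
        (∑ i ∈ s, (E i).indicator (1 : Ω → ℝ) x) ^ 2 := by
      rw [sq, Finset.sum_mul_sum]
      simp only [Set.inter_indicator_one, Pi.mul_apply]
    rw [hsq]
    by_cases hx : x ∈ U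
    · rw [Set.indicator_of_mem hx]
      set Z := ∑ i ∈ s, (E i).indicator (1 : Ω → ℝ) x
      have : 1 / (2 * c) * Z ^ 2 + c / 2 * (1 : Ω → ℝ) x - Z = (Z - c) ^ 2 / (2 * c) := by
        simp only [Pi.one_apply]; field_simp; ring
      have h2 : 0 ≤ (Z - c) ^ 2 / (2 * c) := by positivity
      linarith
    · have h0 : ∑ i ∈ s, (E i).indicator (1 : Ω → ℝ) x = 0 := by
        refine Finset.sum_eq_zero fun i hi => Set.indicator_of_notMem (fun h => hx ?_) _
        exact Set.mem_biUnion hi h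
      rw [h0, Set.indicator_of_notMem hx]
      simp
  have hintg (A : Set Ω) (hA : MeasurableSet A) : Integrable (A.indicator (1 : Ω → ℝ)) μ :=
    (integrable_const (1 : ℝ)).indicator hA
  have hval (A : Set Ω) (hA : MeasurableSet A) : ∫ x, A.indicator (1 : Ω → ℝ) x ∂μ = μ.real A :=
    integral_indicator_one hA
  have hm := integral_mono (μ := μ) (integrable_finsetSum s fun i _ => hintg _ (hE i))
    (((integrable_finsetSum s fun i _ => integrable_finsetSum s fun j _ =>
      hintg _ ((hE i).inter (hE j))).const_mul (1 / (2 * c))).add ((hintg U hUm).const_mul (c / 2)))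
    (fun x => hpt x)
  rw [integral_finsetSum s fun i _ => hintg _ (hE i)] at hm
  simp only [Pi.add_apply] at hm
  rw [integral_add ((integrable_finsetSum s fun i _ => integrable_finsetSum s fun j _ =>
      hintg _ ((hE i).inter (hE j))).const_mul (1 / (2 * c))) ((hintg U hUm).const_mul (c / 2)),
    integral_const_mul, integral_const_mul, hval U hUm,
    integral_finsetSum s (fun i _ => integrable_finsetSum s fun j _ =>
      hintg _ ((hE i).inter (hE j)))] at hm
  simp only [hval _ (hE _)] at hm
  rw [Finset.sum_congr rfl fun i _ => (integral_finsetSum s fun j _ =>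
      hintg _ ((hE i).inter (hE j)))] at hm
  simp only [hval _ ((hE _).inter (hE _))] at hm
  exact hm

lemma sum_card_close_rationals_le (q q' : ℕ) (hq : 0 < q) (hq' : 0 < q') (ρ : ℝ) (hρ : 0 ≤ ρ) :
    ∑ a ∈ Finset.range q, ∑ b ∈ Finset.range q',
      (if ((a / q : ℝ) : UnitAddCircle) ≠ ((b / q' : ℝ) : UnitAddCircle) ∧
        ‖((a / q : ℝ) : UnitAddCircle) - ((b / q' : ℝ) : UnitAddCircle)‖ ≤ ρ then (1 : ℝ) else 0) ≤
      2 * ρ * (q * q') := by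
  have : NeZero q := ⟨hq.ne'⟩
  have : NeZero q' := ⟨hq'.ne'⟩
  let f : ZMod q × ZMod q' →+ UnitAddCircle :=
    (ZMod.toAddCircle (N := q)).comp (AddMonoidHom.fst _ _) -
      (ZMod.toAddCircle (N := q')).comp (AddMonoidHom.snd _ _)
  have h := sum_norm_addMonoidHom_le f (fun t => if t ≤ ρ then 1 else 0)
    (fun t => by positivity) ρ (fun L n hL => by
      have hL' : (0 : ℝ) < L := by exact_mod_cast hL
      rw [Finset.sum_boole]
      have hsub : (Finset.Icc 1 n).filter (fun k : ℕ => (k : ℝ) / L ≤ ρ) ⊆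
          Finset.Icc 1 ⌊ρ * L⌋₊ := by
        intro k hk
        obtain ⟨h1, h2⟩ := Finset.mem_filter.1 hk
        rw [div_le_iff₀ hL'] at h2
        exact Finset.mem_Icc.2 ⟨(Finset.mem_Icc.1 h1).1, Nat.le_floor h2⟩
      have h3 := Finset.card_le_card hsub
      rw [Nat.card_Icc, Nat.add_sub_cancel] at h3
      exact (Nat.cast_le.2 h3).trans (Nat.floor_le (by positivity)))
  rw [Fintype.card_prod, ZMod.card, ZMod.card] at h
  push_cast at h
  refine le_trans (le_of_eq ?_) h
  rw [Finset.sum_filter, Fintype.sum_prod_type]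
  have e (a : ℕ) : ((a / q : ℝ) : UnitAddCircle) = ZMod.toAddCircle (a : ZMod q) :=
    (ZMod.toAddCircle_natCast a).symm
  have e' (a : ℕ) : ((a / q' : ℝ) : UnitAddCircle) = ZMod.toAddCircle (a : ZMod q') :=
    (ZMod.toAddCircle_natCast a).symm
  simp only [e, e']
  have s1 := sum_range_zmod q (fun z : ZMod q => ∑ b ∈ Finset.range q',
    if ZMod.toAddCircle z ≠ ZMod.toAddCircle (b : ZMod q') ∧
      ‖ZMod.toAddCircle z - ZMod.toAddCircle (b : ZMod q')‖ ≤ ρ then (1 : ℝ) else 0)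
  rw [s1]
  refine Finset.sum_congr rfl fun z _ => ?_
  have s2 := sum_range_zmod q' (fun w : ZMod q' =>
    if ZMod.toAddCircle z ≠ ZMod.toAddCircle w ∧
      ‖ZMod.toAddCircle z - ZMod.toAddCircle w‖ ≤ ρ then (1 : ℝ) else 0)
  rw [s2]
  refine Finset.sum_congr rfl fun w _ => ?_
  rw [ite_and]
  have : f (z, w) = ZMod.toAddCircle z - ZMod.toAddCircle w := rfl
  rw [this]
  simp only [ne_eq, sub_eq_zero]

lemma isProbabilityMeasure_unitAddCircle :
    IsProbabilityMeasure (volume : Measure UnitAddCircle) :=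
  ⟨by rw [AddCircle.measure_univ, ENNReal.ofReal_one]⟩

/-- Second-moment lower bound for the measure of a union of balls around reduced fractions. -/
lemma measureReal_iUnion_closedBall_ge (r : ℕ → ℝ) (hr0 : ∀ q, 0 ≤ r q) (hr1 : ∀ q, r q ≤ 1 / 2)
    (hdiv : Tendsto (fun N => ∑ q ∈ Finset.range N, q * r q) atTop atTop)
    (htot : ∀ N, (∑ q ∈ Finset.range N, q * r q) / 2 ≤
      ∑ q ∈ Finset.range N, Nat.totient q * r q) (m : ℕ) (hm : 0 < m) :
    (1 / 40 : ℝ) ≤ volume.real (⋃ q ∈ {q : ℕ | m ≤ q}, ⋃ p ∈ {p : ℕ | p.gcd q = 1 ∧ p < q},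
      Metric.closedBall ((p / q : ℝ) : UnitAddCircle) (r q)) := by
  classical
  have : IsProbabilityMeasure (volume : Measure UnitAddCircle) := isProbabilityMeasure_unitAddCircle
  obtain ⟨N, hN⟩ := ((hdiv.eventually_ge_atTop
    (4 * ∑ q ∈ Finset.range m, Nat.totient q * r q + 1)).and (eventually_ge_atTop m)).exists
  obtain ⟨hN, hmN⟩ := hN
  set X := ∑ q ∈ Finset.range N, (q : ℝ) * r q with hX
  have hm0 : 0 ≤ ∑ q ∈ Finset.range m, Nat.totient q * r q :=
    Finset.sum_nonneg fun q _ => mul_nonneg (Nat.cast_nonneg _) (hr0 q)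
  have hX1 : 1 ≤ X := by linarith
  set s : Finset (Σ _ : ℕ, ℕ) := (Finset.Ico m N).sigma
    fun q => (Finset.range q).filter fun p => p.gcd q = 1 with hs
  let pt : (Σ _ : ℕ, ℕ) → UnitAddCircle := fun i => ((i.2 / i.1 : ℝ) : UnitAddCircle)
  let E : (Σ _ : ℕ, ℕ) → Set UnitAddCircle := fun i => Metric.closedBall (pt i) (r i.1)
  have hEm (i) : MeasurableSet (E i) := measurableSet_closedBall
  have hvol (i) : volume.real (E i) = 2 * r i.1 := by
    have : volume (E i) = ENNReal.ofReal (min 1 (2 * r i.1)) := AddCircle.volume_closedBall 1 _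
    rw [measureReal_def, this, min_eq_right (by linarith [hr1 i.1]),
      ENNReal.toReal_ofReal (by linarith [hr0 i.1])]
  have hfirst : ∑ i ∈ s, volume.real (E i) =
      2 * ∑ q ∈ Finset.Ico m N, Nat.totient q * r q := by
    rw [hs, Finset.sum_sigma, Finset.mul_sum]
    refine Finset.sum_congr rfl fun q _ => ?_
    simp only [hvol]
    rw [Finset.sum_const, nsmul_eq_mul]
    have : ((Finset.range q).filter fun p => p.gcd q = 1).card = Nat.totient q := by
      rw [Nat.totient_eq_card_coprime]
      congr 1
      ext p
      simp [Nat.coprime_comm, Nat.Coprime]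
    rw [this]; ring
  have hlow : X / 4 ≤ ∑ q ∈ Finset.Ico m N, Nat.totient q * r q := by
    have h1 := htot N
    rw [← Finset.sum_range_add_sum_Ico (fun q => (Nat.totient q : ℝ) * r q) hmN] at h1
    linarith
  have hupp : ∑ q ∈ Finset.Ico m N, Nat.totient q * r q ≤ X := by
    calc ∑ q ∈ Finset.Ico m N, Nat.totient q * r q ≤ ∑ q ∈ Finset.Ico m N, q * r q :=
          Finset.sum_le_sum fun q _ => mul_le_mul_of_nonneg_right
            (Nat.cast_le.2 (Nat.totient_le q)) (hr0 q)
      _ ≤ X := Finset.sum_le_sum_of_subset_of_nonneg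
          (fun q hq => Finset.mem_range.2 (Finset.mem_Ico.1 hq).2)
          fun q _ _ => mul_nonneg (Nat.cast_nonneg _) (hr0 q)
  have hord (i) (hi : i ∈ s) : addOrderOf (pt i) = i.1 := by
    rw [hs, Finset.mem_sigma, Finset.mem_Ico, Finset.mem_filter] at hi
    have := AddCircle.addOrderOf_div_of_gcd_eq_one (p := (1 : ℝ)) (m := i.2) (n := i.1)
      (by omega) hi.2.2
    rwa [mul_one] at this
  have hinj (i) (hi : i ∈ s) (j) (hj : j ∈ s) (h : pt i = pt j) : i = j := by
    have h1 : i.1 = j.1 := by rw [← hord i hi, ← hord j hj, h]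
    rw [hs, Finset.mem_sigma, Finset.mem_Ico, Finset.mem_filter, Finset.mem_range] at hi hj
    obtain ⟨q, a⟩ := i
    obtain ⟨q', b⟩ := j
    obtain rfl : q = q' := h1
    have hq : (0 : ℝ) < q := by
      have : 0 < q := by have := hi.1.1; simp only at this; omega
      exact_mod_cast this
    have h2 := (AddCircle.coe_eq_coe_iff_of_mem_Ico (p := (1 : ℝ)) (a := 0)
      (x := a / q) (y := b / q)
      ⟨by positivity, by rw [zero_add, div_lt_one hq]; exact_mod_cast hi.2.1⟩
      ⟨by positivity, by rw [zero_add, div_lt_one hq]; exact_mod_cast hj.2.1⟩).1 h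
    have h3 : (a : ℝ) = b := by field_simp at h2; exact h2
    have h4 : a = b := by exact_mod_cast h3
    rw [h4]
  let w : (Σ _ : ℕ, ℕ) → (Σ _ : ℕ, ℕ) → ℝ := fun i j =>
    if pt i ≠ pt j ∧ ‖pt i - pt j‖ ≤ r i.1 + r j.1 then 1 else 0
  have hw0 (i j) : 0 ≤ w i j := by simp only [w]; positivity
  have hpair (i) (hi : i ∈ s) (j) (hj : j ∈ s) : volume.real (E i ∩ E j) ≤
      (if i = j then volume.real (E i) else 0) + 2 * min (r i.1) (r j.1) * w i j := by
    have hmin : 0 ≤ min (r i.1) (r j.1) := le_min (hr0 _) (hr0 _)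
    by_cases hij : i = j
    · subst hij
      rw [Set.inter_self, if_pos rfl]
      have := mul_nonneg (mul_nonneg (by norm_num : (0 : ℝ) ≤ 2) hmin) (hw0 i i)
      linarith
    · rw [if_neg hij, zero_add]
      by_cases hd : ‖pt i - pt j‖ ≤ r i.1 + r j.1
      · have hw1 : w i j = 1 := if_pos ⟨fun h => hij (hinj i hi j hj h), hd⟩
        rw [hw1, mul_one, mul_min_of_nonneg _ _ (by norm_num), ← hvol i, ← hvol j]
        exact le_min (measureReal_mono Set.inter_subset_left)
          (measureReal_mono Set.inter_subset_right)
      · have : E i ∩ E j = ∅ := by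
          rw [← Set.disjoint_iff_inter_eq_empty]
          refine Metric.closedBall_disjoint_closedBall ?_
          rw [dist_eq_norm]
          exact not_le.1 hd
        rw [this, measureReal_empty]
        exact mul_nonneg (mul_nonneg (by norm_num) hmin) (hw0 i j)
  have hsecond : ∑ i ∈ s, ∑ j ∈ s, volume.real (E i ∩ E j) ≤ 2 * X + 8 * X ^ 2 := by
    calc ∑ i ∈ s, ∑ j ∈ s, volume.real (E i ∩ E j)
        ≤ ∑ i ∈ s, ∑ j ∈ s, ((if i = j then volume.real (E i) else 0) +
            2 * min (r i.1) (r j.1) * w i j) :=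
          Finset.sum_le_sum fun i hi => Finset.sum_le_sum fun j hj => hpair i hi j hj
      _ = ∑ i ∈ s, volume.real (E i) + ∑ i ∈ s, ∑ j ∈ s, 2 * min (r i.1) (r j.1) * w i j := by
          simp only [Finset.sum_add_distrib]
          congr 1
          refine Finset.sum_congr rfl fun i hi => ?_
          rw [Finset.sum_ite_eq, if_pos hi]
      _ ≤ 2 * X + 8 * X ^ 2 := by
          refine add_le_add (by rw [hfirst]; linarith) ?_
          have hin (q q' : ℕ) (hq : 0 < q) (hq' : 0 < q') :
              ∑ a ∈ (Finset.range q).filter (fun p => p.gcd q = 1),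
                ∑ b ∈ (Finset.range q').filter (fun p => p.gcd q' = 1),
                  2 * min (r q) (r q') * w ⟨q, a⟩ ⟨q', b⟩ ≤ 8 * ((q * r q) * (q' * r q')) := by
            have hmin : 0 ≤ min (r q) (r q') := le_min (hr0 _) (hr0 _)
            have hc := sum_card_close_rationals_le q q' hq hq' (r q + r q')
              (add_nonneg (hr0 _) (hr0 _))
            calc _ ≤ ∑ a ∈ Finset.range q, ∑ b ∈ Finset.range q',
                  2 * min (r q) (r q') * w ⟨q, a⟩ ⟨q', b⟩ := by
                  refine (Finset.sum_le_sum fun a _ =>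
                    Finset.sum_le_sum_of_subset_of_nonneg (Finset.filter_subset _ _)
                      fun b _ _ => ?_).trans
                    (Finset.sum_le_sum_of_subset_of_nonneg (Finset.filter_subset _ _)
                      fun a _ _ => Finset.sum_nonneg fun b _ => ?_)
                  all_goals exact mul_nonneg (mul_nonneg (by norm_num) hmin) (hw0 _ _)
              _ = 2 * min (r q) (r q') * ∑ a ∈ Finset.range q, ∑ b ∈ Finset.range q',
                  w ⟨q, a⟩ ⟨q', b⟩ := by
                  simp only [Finset.mul_sum]
              _ ≤ 2 * min (r q) (r q') * (2 * (r q + r q') * (q * q')) :=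
                  mul_le_mul_of_nonneg_left hc (mul_nonneg (by norm_num) hmin)
              _ ≤ _ := by
                  have : min (r q) (r q') * (r q + r q') ≤ 2 * (r q * r q') := by
                    rcases le_total (r q) (r q') with h | h
                    · rw [min_eq_left h]; nlinarith [hr0 q]
                    · rw [min_eq_right h]; nlinarith [hr0 q']
                  have hqq : (0 : ℝ) ≤ 4 * (q * q') := by positivity
                  nlinarith [mul_le_mul_of_nonneg_left this hqq]
          calc ∑ i ∈ s, ∑ j ∈ s, 2 * min (r i.1) (r j.1) * w i j
              = ∑ q ∈ Finset.Ico m N, ∑ q' ∈ Finset.Ico m N,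
                ∑ a ∈ (Finset.range q).filter (fun p => p.gcd q = 1),
                ∑ b ∈ (Finset.range q').filter (fun p => p.gcd q' = 1),
                  2 * min (r q) (r q') * w ⟨q, a⟩ ⟨q', b⟩ := by
                rw [hs, Finset.sum_sigma]
                refine Finset.sum_congr rfl fun q _ => ?_
                simp only [Finset.sum_sigma]
                rw [Finset.sum_comm]
            _ ≤ ∑ q ∈ Finset.Ico m N, ∑ q' ∈ Finset.Ico m N, 8 * ((q * r q) * (q' * r q')) :=
                Finset.sum_le_sum fun q hq => Finset.sum_le_sum fun q' hq' =>
                  hin q q' (by have := (Finset.mem_Ico.1 hq).1; omega)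
                    (by have := (Finset.mem_Ico.1 hq').1; omega)
            _ = 8 * (∑ q ∈ Finset.Ico m N, (q : ℝ) * r q) ^ 2 := by
                rw [sq, Finset.sum_mul_sum]
                simp only [Finset.mul_sum]
            _ ≤ 8 * X ^ 2 := by
                have h1 : ∑ q ∈ Finset.Ico m N, (q : ℝ) * r q ≤ X :=
                  Finset.sum_le_sum_of_subset_of_nonneg
                    (fun q hq => Finset.mem_range.2 (Finset.mem_Ico.1 hq).2)
                    fun q _ _ => mul_nonneg (Nat.cast_nonneg _) (hr0 q)
                have h0 : 0 ≤ ∑ q ∈ Finset.Ico m N, (q : ℝ) * r q :=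
                  Finset.sum_nonneg fun q _ => mul_nonneg (Nat.cast_nonneg _) (hr0 q)
                nlinarith
  have key := sum_measureReal_le_union volume s E hEm (20 * X) (by linarith)
  have hsub : (⋃ i ∈ s, E i) ⊆ ⋃ q ∈ {q : ℕ | m ≤ q}, ⋃ p ∈ {p : ℕ | p.gcd q = 1 ∧ p < q},
      Metric.closedBall ((p / q : ℝ) : UnitAddCircle) (r q) := by
    refine Set.iUnion₂_subset fun i hi => ?_
    rw [hs, Finset.mem_sigma, Finset.mem_Ico, Finset.mem_filter, Finset.mem_range] at hi
    exact Set.subset_biUnion_of_mem (u := fun q : ℕ => ⋃ p ∈ {p : ℕ | p.gcd q = 1 ∧ p < q},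
      Metric.closedBall ((p / q : ℝ) : UnitAddCircle) (r q)) hi.1.1 |>.trans' <|
      Set.subset_biUnion_of_mem (u := fun p : ℕ =>
        Metric.closedBall ((p / i.1 : ℝ) : UnitAddCircle) (r i.1)) (⟨hi.2.2, hi.2.1⟩ :
          i.2 ∈ {p : ℕ | p.gcd i.1 = 1 ∧ p < i.1})
  refine le_trans ?_ (measureReal_mono hsub (measure_ne_top _ _))
  have h1 : 1 / (2 * (20 * X)) * ∑ i ∈ s, ∑ j ∈ s, volume.real (E i ∩ E j) ≤ X / 4 := by
    rw [one_div, inv_mul_le_iff₀ (by linarith)]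
    nlinarith
  rw [hfirst] at key
  have h2 : X / 4 ≤ 20 * X / 2 * volume.real (⋃ i ∈ s, E i) := by linarith
  have h3 : X * (1 / 40) ≤ X * volume.real (⋃ i ∈ s, E i) := by linarith
  exact le_of_mul_le_mul_left h3 (by linarith)

lemma ae_mem_addWellApproximable (δ : ℕ → ℝ) (hδ0 : ∀ q, 0 < q → 0 < δ q) (hδ : ∀ q, 0 ≤ δ q)
    (hδ1 : ∀ q, δ q ≤ 1) (hlim : Tendsto δ atTop (𝓝 0))
    (hdiv : Tendsto (fun N => ∑ q ∈ Finset.range N, q * δ q) atTop atTop)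
    (htot : ∀ N, (∑ q ∈ Finset.range N, q * δ q) / 2 ≤
      ∑ q ∈ Finset.range N, Nat.totient q * δ q) :
    ∀ᵐ x : UnitAddCircle, x ∈ addWellApproximable UnitAddCircle δ := by
  have : IsProbabilityMeasure (volume : Measure UnitAddCircle) := isProbabilityMeasure_unitAddCircle
  rcases AddCircle.addWellApproximable_ae_empty_or_univ (T := 1) δ hlim with h | h
  · exfalso
    let U : ℕ → Set UnitAddCircle := fun m => ⋃ q ∈ {q : ℕ | m + 1 ≤ q},
      ⋃ p ∈ {p : ℕ | p.gcd q = 1 ∧ p < q},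
      Metric.closedBall ((p / q : ℝ) : UnitAddCircle) (δ q / 2)
    have hU (m : ℕ) : (1 / 40 : ℝ) ≤ volume.real (U m) := by
      refine measureReal_iUnion_closedBall_ge (fun q => δ q / 2) (fun q => by linarith [hδ q])
        (fun q => by linarith [hδ1 q]) ?_ ?_ (m + 1) (Nat.succ_pos m)
      · have := hdiv.const_mul_atTop (by norm_num : (0 : ℝ) < 1 / 2)
        refine this.congr fun N => ?_
        rw [Finset.mul_sum]
        exact Finset.sum_congr rfl fun q _ => by ring
      · intro N
        have h1 : ∑ q ∈ Finset.range N, (q : ℝ) * (δ q / 2) =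
            (∑ q ∈ Finset.range N, (q : ℝ) * δ q) / 2 := by
          rw [Finset.sum_div]; exact Finset.sum_congr rfl fun q _ => by ring
        have h2 : ∑ q ∈ Finset.range N, (Nat.totient q : ℝ) * (δ q / 2) =
            (∑ q ∈ Finset.range N, (Nat.totient q : ℝ) * δ q) / 2 := by
          rw [Finset.sum_div]; exact Finset.sum_congr rfl fun q _ => by ring
        rw [h1, h2]
        linarith [htot N]
    have hanti : Antitone U := by
      intro a b hab
      refine Set.biUnion_mono (fun q hq => ?_) fun _ _ => subset_rfl
      have : b + 1 ≤ q := hq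
      show a + 1 ≤ q
      omega
    have hmeas (m : ℕ) : MeasurableSet (U m) :=
      MeasurableSet.biUnion (Set.to_countable _) fun q _ =>
        MeasurableSet.biUnion (Set.to_countable _) fun p _ => measurableSet_closedBall
    have hsub : (⋂ m, U m) ⊆ addWellApproximable UnitAddCircle δ := by
      intro x hx
      rw [UnitAddCircle.mem_addWellApproximable_iff]
      refine Set.infinite_of_not_bddAbove ?_
      rintro ⟨M, hM⟩
      have hxM := Set.mem_iInter.1 hx M
      simp only [U, Set.mem_iUnion] at hxM
      obtain ⟨q, hq, p, hp, hxp⟩ := hxM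
      have hq' : M + 1 ≤ q := hq
      have := hM (show q ∈ _ from ⟨p, hp.2, hp.1, by
        rw [← dist_eq_norm]
        have h1 := Metric.mem_closedBall.1 hxp
        have := hδ0 q (by omega)
        linarith⟩)
      omega
    have h0 : volume (⋂ m, U m) = 0 := by
      refine measure_mono_null (fun x hx => ?_) (ae_iff.1 h)
      simp only [not_not]
      exact hsub hx
    rw [hanti.measure_iInter (fun m => (hmeas m).nullMeasurableSet) ⟨0, measure_ne_top _ _⟩] at h0
    have h1 : ENNReal.ofReal (1 / 40) ≤ ⨅ m, volume (U m) := by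
      refine le_iInf fun m => ?_
      rw [ENNReal.ofReal_le_iff_le_toReal (measure_ne_top _ _)]
      exact hU m
    rw [h0] at h1
    simp at h1
  · exact h

noncomputable def harmSum (n : ℕ) : ℝ := ∑ i ∈ Finset.range n, 1 / (i + 1 : ℝ)

noncomputable def logHarmSum (n : ℕ) : ℝ :=
  ∑ i ∈ Finset.range n, 1 / (i + 1 : ℝ) / harmSum (i + 1)

noncomputable def khinchinRadius (q : ℕ) : ℝ := 1 / (q ^ 2 * harmSum q * logHarmSum q)

lemma monotone_harmSum : Monotone harmSum := fun a b hab =>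
  Finset.sum_le_sum_of_subset_of_nonneg (Finset.range_mono hab) fun i _ _ => by positivity

lemma one_le_harmSum (n : ℕ) : 1 ≤ harmSum (n + 1) :=
  le_trans (by simp [harmSum]) (monotone_harmSum (Nat.succ_le_succ (Nat.zero_le n)))

lemma monotone_logHarmSum : Monotone logHarmSum := fun a b hab =>
  Finset.sum_le_sum_of_subset_of_nonneg (Finset.range_mono hab) fun i _ _ =>
    div_nonneg (by positivity) (zero_le_one.trans (one_le_harmSum i))

lemma one_le_logHarmSum (n : ℕ) : 1 ≤ logHarmSum (n + 1) :=
  le_trans (by simp [logHarmSum, harmSum]) (monotone_logHarmSum (Nat.succ_le_succ (Nat.zero_le n)))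

lemma khinchinRadius_nonneg (q : ℕ) : 0 ≤ khinchinRadius q := by
  rcases q with _ | n
  · simp [khinchinRadius]
  · have := one_le_harmSum n
    have := one_le_logHarmSum n
    unfold khinchinRadius
    positivity

lemma khinchinRadius_pos (n : ℕ) : 0 < khinchinRadius (n + 1) := by
  have := one_le_harmSum n
  have := one_le_logHarmSum n
  unfold khinchinRadius
  positivity

lemma khinchinRadius_le (q : ℕ) : khinchinRadius q ≤ 1 / (q : ℝ) ^ 2 := by
  rcases q with _ | n
  · simp [khinchinRadius]
  · unfold khinchinRadius
    refine one_div_le_one_div_of_le (by positivity) ?_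
    rw [mul_assoc]
    exact le_mul_of_one_le_right (by positivity)
      (one_le_mul_of_one_le_of_one_le (one_le_harmSum n) (one_le_logHarmSum n))

lemma succ_mul_khinchinRadius (n : ℕ) : ((n + 1 : ℕ) : ℝ) * khinchinRadius (n + 1) =
    1 / (n + 1 : ℝ) / harmSum (n + 1) / logHarmSum (n + 1) := by
  have := one_le_harmSum n
  have := one_le_logHarmSum n
  unfold khinchinRadius
  push_cast
  field_simp

lemma not_summable_one_div_succ : ¬ Summable fun n : ℕ => 1 / (n + 1 : ℝ) := by
  intro h
  have : Summable fun n : ℕ => 1 / (n : ℝ) := by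
    rw [← summable_nat_add_iff 1]
    simpa using h
  exact Real.not_summable_one_div_natCast this

lemma tendsto_sum_mul_khinchinRadius :
    Tendsto (fun N => ∑ q ∈ Finset.range N, q * khinchinRadius q) atTop atTop := by
  have h1 : ¬ Summable fun n : ℕ => 1 / (n + 1 : ℝ) / harmSum (n + 1) :=
    not_summable_div_partialSum (fun n => by positivity) not_summable_one_div_succ
  have h2 : ¬ Summable fun n : ℕ => 1 / (n + 1 : ℝ) / harmSum (n + 1) / logHarmSum (n + 1) :=
    not_summable_div_partialSum
      (fun n => div_pos (by positivity) (zero_lt_one.trans_le (one_le_harmSum n))) h1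
  refine tendsto_sum_range_atTop_of_not_summable
    (fun q => mul_nonneg (Nat.cast_nonneg q) (khinchinRadius_nonneg q)) fun h => h2 ?_
  refine ((summable_nat_add_iff 1).2 h).congr fun n => ?_
  exact succ_mul_khinchinRadius n

lemma summable_khinchinRadius_div :
    Summable fun n : ℕ => 1 / (n + 1 : ℝ) / harmSum (n + 1) / logHarmSum (n + 1) ^ 2 :=
  summable_div_partialSum_sq
    (fun n => div_pos (by positivity) (zero_lt_one.trans_le (one_le_harmSum n)))

lemma half_sum_mul_khinchinRadius_le (N : ℕ) :
    (∑ q ∈ Finset.range N, q * khinchinRadius q) / 2 ≤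
      ∑ q ∈ Finset.range N, Nat.totient q * khinchinRadius q := by
  rcases N with _ | N
  · simp
  rw [Finset.sum_range_succ', Finset.sum_range_succ']
  simp only [Nat.totient_zero, Nat.cast_zero, zero_mul, add_zero]
  have h := sum_mul_le_sum_mul_of_antitone (fun i => (Nat.totient (i + 1) : ℝ) / (i + 1))
    (fun _ => 1 / 2) (fun n => ((n + 1 : ℕ) : ℝ) * khinchinRadius (n + 1)) ?_
    (fun n => mul_nonneg (Nat.cast_nonneg _) (khinchinRadius_nonneg _))
    half_mul_le_sum_totient_div N
  · rw [Finset.sum_div]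
    refine le_trans (le_of_eq (Finset.sum_congr rfl fun i _ => by ring))
      (h.trans (le_of_eq (Finset.sum_congr rfl fun i _ => ?_)))
    push_cast
    field_simp
  · intro a b hab
    simp only [succ_mul_khinchinRadius]
    have h1 := one_le_harmSum a
    have h2 := one_le_logHarmSum a
    have h3 : harmSum (a + 1) ≤ harmSum (b + 1) := monotone_harmSum (by omega)
    have h4 : logHarmSum (a + 1) ≤ logHarmSum (b + 1) := monotone_logHarmSum (by omega)
    have h5 : (a : ℝ) ≤ b := by exact_mod_cast hab
    gcongr

lemma exists_coe_eq_norm_eq_abs (x : UnitAddCircle) :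
    ∃ t : ℝ, (t : UnitAddCircle) = x ∧ |t| = ‖x‖ := by
  obtain ⟨y, rfl⟩ := QuotientAddGroup.mk_surjective x
  refine ⟨y - round y, ?_, ?_⟩
  · rw [AddCircle.coe_sub]
    have : ((round y : ℝ) : UnitAddCircle) = 0 :=
      (AddCircle.coe_eq_zero_iff (1 : ℝ)).2 ⟨round y, by simp⟩
    rw [this, sub_zero]
  · exact (UnitAddCircle.norm_eq (x := y)).symm

lemma ae_ne_coe_div :
    ∀ᵐ α : UnitAddCircle, ∀ p q : ℕ, α ≠ ((p / q : ℝ) : UnitAddCircle) := by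
  have h (x : UnitAddCircle) : ∀ᵐ α : UnitAddCircle, α ≠ x := by
    rw [ae_iff]
    simp only [ne_eq, not_not, Set.ofPred_eq_eq_singleton]
    have := AddCircle.volume_closedBall 1 (x := x) 0
    rw [Metric.closedBall_zero] at this
    rw [this]
    simp
  rw [ae_all_iff]
  intro p
  rw [ae_all_iff]
  intro q
  exact h _

/-- The balls around the fractions with denominator `n + 1` whose resonance sum is large. -/
def resonantBalls (κ : ℝ) (n : ℕ) : Set UnitAddCircle :=
  ⋃ p ∈ {p : ℕ | p < n + 1 ∧ IsUnit (p : ZMod (n + 1)) ∧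
    (harmSum (n + 1) * logHarmSum (n + 1)) ^ 2 < resonanceSum (n + 1) (p : ZMod (n + 1))},
    Metric.closedBall ((p / (n + 1 : ℕ) : ℝ) : UnitAddCircle) (κ * khinchinRadius (n + 1))

open scoped Classical in
lemma volume_resonantBalls_le (κ : ℝ) (hκ : 0 ≤ κ) (n : ℕ) :
    volume (resonantBalls κ n) ≤ ENNReal.ofReal
      (32 * κ * (1 / (n + 1 : ℝ) / harmSum (n + 1) / logHarmSum (n + 1) ^ 2)) := by
  have hH := one_le_harmSum n
  have hT := one_le_logHarmSum n
  set B : Finset ℕ := {p ∈ Finset.range (n + 1) | IsUnit (p : ZMod (n + 1)) ∧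
    (harmSum (n + 1) * logHarmSum (n + 1)) ^ 2 < resonanceSum (n + 1) (p : ZMod (n + 1))} with hB
  have hcard : (B.card : ℝ) ≤ 16 * (n + 1 : ℕ) / (harmSum (n + 1) * logHarmSum (n + 1)) *
      harmSum (n + 1) := by
    refine le_trans ?_ (card_resonanceSum_gt_le (n + 1) (harmSum (n + 1) * logHarmSum (n + 1))
      (by positivity))
    rw [Nat.cast_le]
    refine Finset.card_le_card_of_injOn (fun p : ℕ => (p : ZMod (n + 1))) (fun p hp => ?_)
      (fun a ha b hb h => ?_)
    · have := (Finset.mem_filter.1 hp).2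
      simpa using this
    · have ha := Finset.mem_range.1 (Finset.mem_filter.1 ha).1
      have hb := Finset.mem_range.1 (Finset.mem_filter.1 hb).1
      have := (ZMod.natCast_eq_natCast_iff' a b (n + 1)).1 h
      rwa [Nat.mod_eq_of_lt ha, Nat.mod_eq_of_lt hb] at this
  have hball (x : UnitAddCircle) : volume (Metric.closedBall x (κ * khinchinRadius (n + 1))) ≤
      ENNReal.ofReal (2 * (κ * khinchinRadius (n + 1))) := by
    refine (AddCircle.volume_closedBall 1 _).le.trans (ENNReal.ofReal_le_ofReal (min_le_right _ _))
  calc volume (resonantBalls κ n)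
      ≤ ∑ p ∈ B, volume (Metric.closedBall ((p / (n + 1 : ℕ) : ℝ) : UnitAddCircle)
          (κ * khinchinRadius (n + 1))) := by
        have : resonantBalls κ n = ⋃ p ∈ B, Metric.closedBall
            ((p / (n + 1 : ℕ) : ℝ) : UnitAddCircle) (κ * khinchinRadius (n + 1)) := by
          simp [resonantBalls, hB]
        rw [this]
        exact measure_biUnion_finset_le _ _
    _ ≤ ∑ p ∈ B, ENNReal.ofReal (2 * (κ * khinchinRadius (n + 1))) :=
        Finset.sum_le_sum fun p _ => hball _
    _ = ENNReal.ofReal (B.card * (2 * (κ * khinchinRadius (n + 1)))) := by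
        rw [Finset.sum_const, nsmul_eq_mul, ENNReal.ofReal_mul (Nat.cast_nonneg _),
          ENNReal.ofReal_natCast]
    _ ≤ _ := by
        refine ENNReal.ofReal_le_ofReal ?_
        have h0 : 0 ≤ 2 * (κ * khinchinRadius (n + 1)) := by
          have := khinchinRadius_nonneg (n + 1)
          positivity
        refine (mul_le_mul_of_nonneg_right hcard h0).trans (le_of_eq ?_)
        unfold khinchinRadius
        push_cast
        field_simp
        ring

lemma ae_exists_nonresonant_approx (K : ℕ) :
    ∀ᵐ α : UnitAddCircle, ∃ (n : ℕ) (p : ℤ) (ε : ℝ), IsUnit (p : ZMod (n + 1)) ∧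
      ((p / (n + 1 : ℕ) + ε : ℝ) : UnitAddCircle) = α ∧ ε ≠ 0 ∧
      |((n + 1 : ℕ) : ℝ) ^ 2 * ε| ≤ 1 / (K + 1) ∧
      |((n + 1 : ℕ) : ℝ) ^ 2 * ε| * √(resonanceSum (n + 1) (p : ZMod (n + 1))) ≤ 1 / (K + 1) := by
  set κ : ℝ := 1 / (K + 1) with hκ
  have hκ0 : 0 < κ := by positivity
  have hκ1 : κ ≤ 1 := by
    rw [hκ, div_le_one (by positivity)]
    have : (0 : ℝ) ≤ K := Nat.cast_nonneg K
    linarith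
  have hlim : Tendsto (fun q : ℕ => κ * khinchinRadius q) atTop (𝓝 0) := by
    rw [← mul_zero κ]
    refine Tendsto.const_mul κ ?_
    refine squeeze_zero khinchinRadius_nonneg khinchinRadius_le ?_
    have := (tendsto_pow_atTop (two_ne_zero)).comp (tendsto_natCast_atTop_atTop (R := ℝ))
    refine this.inv_tendsto_atTop.congr fun n => ?_
    simp
  have hwell := ae_mem_addWellApproximable (fun q => κ * khinchinRadius q)
    (fun q hq => by
      obtain ⟨n, rfl⟩ := Nat.exists_eq_succ_of_ne_zero hq.ne'
      exact mul_pos hκ0 (khinchinRadius_pos n))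
    (fun q => mul_nonneg hκ0.le (khinchinRadius_nonneg q))
    (fun q => by
      refine mul_le_one₀ hκ1 (khinchinRadius_nonneg q) ((khinchinRadius_le q).trans ?_)
      rcases q with _ | n
      · simp
      · rw [div_le_one (by positivity)]
        push_cast
        nlinarith [(Nat.cast_nonneg n : (0 : ℝ) ≤ n)])
    hlim
    ((tendsto_sum_mul_khinchinRadius.const_mul_atTop hκ0).congr fun N => by
      rw [Finset.mul_sum]; exact Finset.sum_congr rfl fun q _ => by ring)
    (fun N => by
      have h := mul_le_mul_of_nonneg_left (half_sum_mul_khinchinRadius_le N) hκ0.le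
      rw [← mul_div_assoc, Finset.mul_sum, Finset.mul_sum] at h
      simpa only [mul_left_comm] using h)
  have hbad : ∀ᵐ α : UnitAddCircle, {n | α ∈ resonantBalls κ n}.Finite := by
    refine ae_finite_setOfPred_mem (ne_top_of_le_ne_top ?_
      (ENNReal.tsum_le_tsum fun n => volume_resonantBalls_le κ hκ0.le n))
    exact (summable_khinchinRadius_div.mul_left (32 * κ)).tsum_ofReal_ne_top
  filter_upwards [hwell, hbad, ae_ne_coe_div] with α h1 h2 h3
  rw [UnitAddCircle.mem_addWellApproximable_iff] at h1
  obtain ⟨q, ⟨p, hpq, hgcd, hlt⟩, hq2⟩ := (h1.sdiff (h2.image (fun n => n + 1))).nonempty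
  obtain ⟨n, rfl⟩ := Nat.exists_eq_succ_of_ne_zero (by omega : q ≠ 0)
  have hn : α ∉ resonantBalls κ n := fun h => hq2 ⟨n, h, rfl⟩
  obtain ⟨ε, hε1, hε2⟩ := exists_coe_eq_norm_eq_abs (α - ((p / (n + 1 : ℕ) : ℝ) : UnitAddCircle))
  have hε3 : |ε| < κ * khinchinRadius (n + 1) := by rw [hε2]; exact hlt
  have hu : IsUnit (p : ZMod (n + 1)) := (ZMod.isUnit_iff_coprime p (n + 1)).2 hgcd
  have hW : resonanceSum (n + 1) (p : ZMod (n + 1)) ≤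
      (harmSum (n + 1) * logHarmSum (n + 1)) ^ 2 := by
    by_contra hcon
    apply hn
    unfold resonantBalls
    refine Set.mem_biUnion (x := p) ?_ ?_
    · exact ⟨hpq, hu, not_le.1 hcon⟩
    · rw [Metric.mem_closedBall, dist_eq_norm]
      exact hlt.le
  have hH := one_le_harmSum n
  have hT := one_le_logHarmSum n
  have hd : |((n + 1 : ℕ) : ℝ) ^ 2 * ε| ≤ κ / (harmSum (n + 1) * logHarmSum (n + 1)) := by
    rw [abs_mul, abs_of_nonneg (by positivity)]
    refine (mul_le_mul_of_nonneg_left hε3.le (by positivity)).trans (le_of_eq ?_)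
    unfold khinchinRadius
    push_cast
    field_simp
  refine ⟨n, p, ε, by exact_mod_cast hu, ?_, ?_, ?_, ?_⟩
  · rw [AddCircle.coe_add, hε1, Int.cast_natCast, add_sub_cancel]
  · rintro rfl
    apply h3 p (n + 1)
    rw [AddCircle.coe_zero] at hε1
    exact (sub_eq_zero.1 hε1.symm)
  · exact hd.trans (div_le_self hκ0.le (one_le_mul_of_one_le_of_one_le hH hT))
  · have : √(resonanceSum (n + 1) ((p : ℤ) : ZMod (n + 1))) ≤
        harmSum (n + 1) * logHarmSum (n + 1) := by
      rw [Int.cast_natCast]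
      exact Real.sqrt_le_iff.2 ⟨by positivity, hW⟩
    refine (mul_le_mul hd this (Real.sqrt_nonneg _) (by positivity)).trans (le_of_eq ?_)
    field_simp

/-- The distribution function of `F` along a uniformly random time in `[0, T]`. -/
noncomputable def occupationCDF (F : ℝ → ℝ) (T y : ℝ) : ℝ :=
  volume.real (Set.Ioc 0 T ∩ {t | F t ≤ y}) / T

lemma continuous_occupationCDF (F : ℝ → ℝ) (hF : Continuous F)
    (hlev : ∀ y, volume {t | F t = y} = 0) (T : ℝ) : Continuous (occupationCDF F T) := by
  have hmeas (y : ℝ) : MeasurableSet {t | F t ≤ y} := (isClosed_le hF continuous_const).measurableSet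
  have e : occupationCDF F T = fun y =>
      (∫ t in Set.Ioc 0 T, {t | F t ≤ y}.indicator (1 : ℝ → ℝ) t) / T := by
    funext y
    rw [integral_indicator_one (hmeas y), measureReal_restrict_apply (hmeas y), Set.inter_comm]
    rfl
  rw [e]
  refine Continuous.div_const (continuous_iff_continuousAt.2 fun y => ?_) T
  refine continuousAt_of_dominated (bound := fun _ => 1) (Eventually.of_forall fun z => ?_)
    (Eventually.of_forall fun z => Eventually.of_forall fun t => ?_) (by simp) ?_
  · exact (stronglyMeasurable_one.indicator (hmeas z)).aestronglyMeasurable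
  · by_cases h : t ∈ {t | F t ≤ z}
    · simp [Set.indicator_of_mem h]
    · simp [Set.indicator_of_notMem h]
  · refine ae_restrict_of_ae ?_
    have : ∀ᵐ t : ℝ, F t ≠ y := by
      rw [ae_iff]; simpa using hlev y
    filter_upwards [this] with t ht
    rcases lt_or_gt_of_ne ht with h | h
    · refine (continuousAt_const (y := (1 : ℝ))).congr ?_
      filter_upwards [lt_mem_nhds h] with z hz
      rw [Set.indicator_of_mem (show t ∈ {t | F t ≤ z} from hz.le)]
      rfl
    · refine (continuousAt_const (y := (0 : ℝ))).congr ?_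
      filter_upwards [gt_mem_nhds h] with z hz
      rw [Set.indicator_of_notMem (show t ∉ {t | F t ≤ z} from not_le.2 hz)]

lemma occupationCDF_eq_zero (F : ℝ → ℝ) (hlev : ∀ y, volume {t | F t = y} = 0) (T a y : ℝ)
    (ha : ∀ t, a ≤ F t) (hy : y ≤ a) : occupationCDF F T y = 0 := by
  unfold occupationCDF
  have : volume (Set.Ioc 0 T ∩ {t | F t ≤ y}) = 0 :=
    measure_mono_null (fun t ht => le_antisymm (ht.2.trans hy) (ha t)) (hlev a)
  rw [measureReal_def, this]
  simp

lemma occupationCDF_eq_one (F : ℝ → ℝ) (T b y : ℝ) (hT : 0 < T)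
    (hb : ∀ t, F t ≤ b) (hy : b ≤ y) : occupationCDF F T y = 1 := by
  unfold occupationCDF
  have : Set.Ioc 0 T ∩ {t | F t ≤ y} = Set.Ioc 0 T :=
    Set.inter_eq_left.2 fun t _ => (hb t).trans hy
  rw [this, Real.volume_real_Ioc_of_le hT.le, sub_zero, div_self hT.ne']

lemma nonempty_Ioo_inter_of_mem (U : Set ℝ) (hU : IsOpen U) (t : ℝ) (ht : t ∈ Set.Icc (0 : ℝ) 1)
    (htU : t ∈ U) : (U ∩ Set.Ioo 0 1).Nonempty := by
  rw [← closure_Ioo (zero_ne_one)] at ht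
  exact mem_closure_iff.1 ht U hU htU

lemma occupationCDF_pos (F : ℝ → ℝ) (hF : Continuous F) (T y t : ℝ) (hT : 1 ≤ T)
    (ht : t ∈ Set.Icc (0 : ℝ) 1) (hty : F t < y) : 0 < occupationCDF F T y := by
  have hU : IsOpen {t | F t < y} := isOpen_lt hF continuous_const
  have h1 := (hU.inter isOpen_Ioo).measure_pos volume (nonempty_Ioo_inter_of_mem _ hU t ht hty)
  have h2 := h1.trans_le (measure_mono (show {t | F t < y} ∩ Set.Ioo 0 1 ⊆
    Set.Ioc 0 T ∩ {t | F t ≤ y} from fun s hs => ⟨⟨hs.2.1, hs.2.2.le.trans hT⟩, show F s ≤ y from le_of_lt hs.1⟩))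
  refine div_pos (ENNReal.toReal_pos h2.ne' ?_) (by linarith)
  exact ne_top_of_le_ne_top (by simp) (measure_mono (Set.inter_subset_left (s := Set.Ioc 0 T)))

lemma occupationCDF_lt_one (F : ℝ → ℝ) (hF : Continuous F) (T y t : ℝ) (hT : 1 ≤ T)
    (ht : t ∈ Set.Icc (0 : ℝ) 1) (hty : y < F t) : occupationCDF F T y < 1 := by
  have hU : IsOpen {t | y < F t} := isOpen_lt continuous_const hF
  have h1 := (hU.inter isOpen_Ioo).measure_pos volume (nonempty_Ioo_inter_of_mem _ hU t ht hty)
  have h2 := h1.trans_le (measure_mono (show {t | y < F t} ∩ Set.Ioo 0 1 ⊆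
    Set.Ioc 0 T \ {t | F t ≤ y} from fun s hs => ⟨⟨hs.2.1, hs.2.2.le.trans hT⟩, show ¬ F s ≤ y from not_le.2 hs.1⟩))
  have hfin : volume (Set.Ioc 0 T \ {t | F t ≤ y}) ≠ ⊤ :=
    ne_top_of_le_ne_top (by simp) (measure_mono (Set.sdiff_subset (s := Set.Ioc 0 T)))
  have h3 := ENNReal.toReal_pos h2.ne' hfin
  have hmeas : MeasurableSet {t | F t ≤ y} := (isClosed_le hF continuous_const).measurableSet
  have h4 := measureReal_inter_add_sdiff (μ := volume) (s := Set.Ioc 0 T) hmeas (by simp)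
  rw [Real.volume_real_Ioc_of_le (by linarith), sub_zero] at h4
  unfold occupationCDF
  rw [div_lt_one (by linarith)]
  have : 0 < volume.real (Set.Ioc 0 T \ {t | F t ≤ y}) := h3
  linarith

/-- The occupation distributions of a nondegenerate periodic function over varying time windows
cannot all be of the same affine type. -/
lemma not_forall_occupationCDF_same_type (F : ℝ → ℝ) (hF : Continuous F)
    (hper : Function.Periodic F 1) (hlev : ∀ y, volume {t | F t = y} = 0) (H : ℝ → ℝ)
    (hH : ∀ T, 1 ≤ T → ∃ β γ : ℝ, 0 < β ∧ ∀ a, H a = occupationCDF F T (β * a + γ)) : False := by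
  obtain ⟨tm, htm, hmin⟩ := isCompact_Icc.exists_isMinOn (Set.nonempty_Icc.2 zero_le_one)
    hF.continuousOn (s := Set.Icc (0 : ℝ) 1)
  obtain ⟨tM, htM, hmax⟩ := isCompact_Icc.exists_isMaxOn (Set.nonempty_Icc.2 zero_le_one)
    hF.continuousOn (s := Set.Icc (0 : ℝ) 1)
  have hfr (t : ℝ) : F t = F (Int.fract t) := by
    have := hper.sub_int_mul_eq ⌊t⌋ (x := t)
    rw [mul_one] at this
    exact this.symm
  have hlo (t : ℝ) : F tm ≤ F t := by
    rw [hfr t]; exact hmin ⟨Int.fract_nonneg t, (Int.fract_lt_one t).le⟩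
  have hhi (t : ℝ) : F t ≤ F tM := by
    rw [hfr t]; exact hmax ⟨Int.fract_nonneg t, (Int.fract_lt_one t).le⟩
  have hne : F tm < F tM := by
    rcases (hlo tM).eq_or_lt with h | h
    · exfalso
      have : {t | F t = F tm} = Set.univ :=
        Set.eq_univ_of_forall fun t => le_antisymm ((hhi t).trans h.symm.le) (hlo t)
      have h2 := hlev (F tm)
      rw [this] at h2
      simp at h2
    · exact h
  have hbd (T : ℝ) (hT : 1 ≤ T) (y : ℝ) :
      (0 < occupationCDF F T y ↔ F tm < y) ∧ (occupationCDF F T y < 1 ↔ y < F tM) := by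
    refine ⟨⟨fun h => ?_, fun h => occupationCDF_pos F hF T y tm hT htm h⟩,
      ⟨fun h => ?_, fun h => occupationCDF_lt_one F hF T y tM hT htM h⟩⟩
    · by_contra hc
      rw [occupationCDF_eq_zero F hlev T (F tm) y hlo (not_lt.1 hc)] at h
      exact lt_irrefl _ h
    · by_contra hc
      rw [occupationCDF_eq_one F T (F tM) y (by linarith) hhi (not_lt.1 hc)] at h
      exact lt_irrefl _ h
  obtain ⟨β, γ, hβ, h1⟩ := hH 1 le_rfl
  have hsame (T : ℝ) (hT : 1 ≤ T) (y : ℝ) : occupationCDF F T y = occupationCDF F 1 y := by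
    obtain ⟨β', γ', hβ', h2⟩ := hH T hT
    have elo (a : ℝ) : F tm < β * a + γ ↔ F tm < β' * a + γ' := by
      rw [← (hbd 1 le_rfl _).1, ← (hbd T hT _).1, ← h1, ← h2]
    have ehi (a : ℝ) : β * a + γ < F tM ↔ β' * a + γ' < F tM := by
      rw [← (hbd 1 le_rfl _).2, ← (hbd T hT _).2, ← h1, ← h2]
    have z1 : (F tm - γ) / β = (F tm - γ') / β' := by
      have (a : ℝ) : (F tm - γ) / β < a ↔ (F tm - γ') / β' < a := by
        rw [div_lt_iff₀ hβ, div_lt_iff₀ hβ', sub_lt_iff_lt_add, sub_lt_iff_lt_add, mul_comm a,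
          mul_comm a]
        exact elo a
      exact eq_of_forall_gt_iff this
    have z2 : (F tM - γ) / β = (F tM - γ') / β' := by
      have (a : ℝ) : a < (F tM - γ) / β ↔ a < (F tM - γ') / β' := by
        rw [lt_div_iff₀ hβ, lt_div_iff₀ hβ', lt_sub_iff_add_lt, lt_sub_iff_add_lt, mul_comm a,
          mul_comm a]
        exact ehi a
      exact eq_of_forall_lt_iff this
    have z3 : (F tM - F tm) / β = (F tM - F tm) / β' := by
      have e1 : (F tM - F tm) / β = (F tM - γ) / β - (F tm - γ) / β := by ring
      have e2 : (F tM - F tm) / β' = (F tM - γ') / β' - (F tm - γ') / β' := by ring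
      rw [e1, e2, z1, z2]
    have z4 : β = β' := by
      have h0 : F tM - F tm ≠ 0 := by linarith
      field_simp at z3
      linarith
    subst z4
    have z5 : γ = γ' := by
      field_simp at z1
      linarith
    subst z5
    have h3 := h1 ((y - γ) / β)
    rw [h2, mul_div_cancel₀ _ hβ.ne', sub_add_cancel] at h3
    exact h3
  set y := (F tm + F tM) / 2 with hy
  have hy1 : F tm < y := by rw [hy]; linarith
  have hy2 : y < F tM := by rw [hy]; linarith
  have hnhds : {t | F t < y} ∈ 𝓝 (tm + 1) :=
    (isOpen_lt hF continuous_const).mem_nhds (by rw [Set.mem_ofPred_eq, hper]; exact hy1)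
  obtain ⟨δ, hδ, hball⟩ := Metric.mem_nhds_iff.1 hnhds
  set T₀ := tm + 1
  have hT₀ : 1 ≤ T₀ := by have := htm.1; linarith
  set T₁ := T₀ + δ / 2 with hT₁
  have hg0 := hsame T₀ hT₀ y
  have hg1 := hsame T₁ (by linarith) y
  have hlt := (hbd 1 le_rfl y).2.2 hy2
  have hsplit : volume.real (Set.Ioc 0 T₁ ∩ {t | F t ≤ y}) =
      volume.real (Set.Ioc 0 T₀ ∩ {t | F t ≤ y}) + δ / 2 := by
    have hmeas : MeasurableSet {t | F t ≤ y} := (isClosed_le hF continuous_const).measurableSet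
    have e1 : Set.Ioc 0 T₁ ∩ {t | F t ≤ y} = (Set.Ioc 0 T₀ ∩ {t | F t ≤ y}) ∪ Set.Ioc T₀ T₁ := by
      ext t
      constructor
      · rintro ⟨ht, hF'⟩
        by_cases h : t ≤ T₀
        · exact Or.inl ⟨⟨ht.1, h⟩, hF'⟩
        · exact Or.inr ⟨not_le.1 h, ht.2⟩
      · rintro (⟨ht, hF'⟩ | ht)
        · exact ⟨⟨ht.1, ht.2.trans (by linarith)⟩, hF'⟩
        · refine ⟨⟨by linarith [ht.1], ht.2⟩, show F t ≤ y from le_of_lt (show F t < y from hball ?_)⟩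
          rw [Metric.mem_ball, Real.dist_eq, abs_lt]
          constructor <;> linarith [ht.1, ht.2]
    rw [e1, measureReal_union _ measurableSet_Ioc
      (ne_top_of_le_ne_top (by simp) (measure_mono (Set.inter_subset_left (s := Set.Ioc 0 T₀))))
      (by simp), Real.volume_real_Ioc_of_le (by linarith)]
    · rw [hT₁]; ring
    · rw [Set.disjoint_left]
      intro t ht ht'
      exact absurd ht.1.2 (not_le.2 ht'.1)
  unfold occupationCDF at hg0 hg1 hlt
  rw [← hg1, hsplit] at hg0
  rw [← hg1, hsplit, div_lt_one (by linarith)] at hlt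
  rw [div_eq_div_iff (by linarith) (by linarith)] at hg0
  set v := volume.real (Set.Ioc 0 T₀ ∩ {t | F t ≤ y})
  have : δ / 2 * (T₀ - v) = 0 := by rw [hT₁] at hg0; linarith
  rcases mul_eq_zero.1 this with h | h
  · linarith
  · linarith

lemma tendsto_of_monotone_of_tendsto {ι : Type*} {l : Filter ι} {C : ι → ℝ → ℝ} {G : ℝ → ℝ}
    (hC : ∀ n, Monotone (C n)) (hG : Continuous G) (h : ∀ y, Tendsto (fun n => C n y) l (𝓝 (G y)))
    {z : ι → ℝ} {w : ℝ} (hz : Tendsto z l (𝓝 w)) : Tendsto (fun n => C n (z n)) l (𝓝 (G w)) := by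
  rw [Metric.tendsto_nhds]
  intro ε hε
  obtain ⟨δ, hδ, hd⟩ := Metric.continuousAt_iff.1 (hG.continuousAt (x := w)) (ε / 2)
    (by linarith)
  have h1 := hd (x := w + δ / 2) (by rw [Real.dist_eq, abs_lt]; constructor <;> linarith)
  have h2 := hd (x := w - δ / 2) (by rw [Real.dist_eq, abs_lt]; constructor <;> linarith)
  filter_upwards [Metric.tendsto_nhds.1 (h (w + δ / 2)) (ε / 2) (by linarith),
    Metric.tendsto_nhds.1 (h (w - δ / 2)) (ε / 2) (by linarith),
    Metric.tendsto_nhds.1 hz (δ / 2) (by linarith)] with n a1 a2 a3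
  rw [Real.dist_eq, abs_lt] at *
  have b1 := hC n (show z n ≤ w + δ / 2 by linarith)
  have b2 := hC n (show w - δ / 2 ≤ z n by linarith)
  constructor <;> linarith

/-- Ultrafilter form of the convergence of types theorem. -/
lemma exists_affine_of_tendsto {ι : Type*} (𝒰 : Ultrafilter ι) {C : ι → ℝ → ℝ} {G H : ℝ → ℝ}
    (hC : ∀ n, Monotone (C n)) (hG : Continuous G)
    (h : ∀ y, Tendsto (fun n => C n y) 𝒰 (𝓝 (G y))) {L U : ℝ} (hL : G L = 0) (hU : G U = 1)
    {β γ : ι → ℝ} (hβ : ∀ n, 0 < β n)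
    (hH : ∀ a, Tendsto (fun n => C n (β n * a + γ n)) 𝒰 (𝓝 (H a))) {a₁ a₂ b₁ b₂ : ℝ}
    (ha : a₁ < a₂) (h1 : H a₁ ∈ Set.Ioo (0 : ℝ) 1) (h2 : H a₂ ∈ Set.Ioo (0 : ℝ) 1)
    (hb : H b₁ ≠ H b₂) : ∃ b c : ℝ, 0 < b ∧ ∀ a, H a = G (b * a + c) := by
  have key (a : ℝ) (h' : H a ∈ Set.Ioo (0 : ℝ) 1) :
      ∀ᶠ n in (𝒰 : Filter ι), β n * a + γ n ∈ Set.Icc L U := by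
    have e1 := (h L).eventually_lt (hH a) (by rw [hL]; exact h'.1)
    have e2 := (hH a).eventually_lt (h U) (by rw [hU]; exact h'.2)
    filter_upwards [e1, e2] with n c1 c2
    constructor
    · by_contra hc
      exact absurd (hC n (not_le.1 hc).le) (not_le.2 c1)
    · by_contra hc
      exact absurd (hC n (not_le.1 hc).le) (not_le.2 c2)
  obtain ⟨z1, -, hz1⟩ := isCompact_Icc.ultrafilter_le_nhds' (𝒰.map fun n => β n * a₁ + γ n)
    (key a₁ h1)
  obtain ⟨z2, -, hz2⟩ := isCompact_Icc.ultrafilter_le_nhds' (𝒰.map fun n => β n * a₂ + γ n)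
    (key a₂ h2)
  have t1 : Tendsto (fun n => β n * a₁ + γ n) 𝒰 (𝓝 z1) := hz1
  have t2 : Tendsto (fun n => β n * a₂ + γ n) 𝒰 (𝓝 z2) := hz2
  have ha' : a₂ - a₁ ≠ 0 := by linarith
  have tβ : Tendsto β 𝒰 (𝓝 ((z2 - z1) / (a₂ - a₁))) := by
    refine ((t2.sub t1).div_const (a₂ - a₁)).congr fun n => ?_
    field_simp
    ring
  set b := (z2 - z1) / (a₂ - a₁)
  have tγ : Tendsto γ 𝒰 (𝓝 (z1 - b * a₁)) := by
    refine (t1.sub (tβ.mul_const a₁)).congr fun n => ?_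
    ring
  set c := z1 - b * a₁
  have hall (a : ℝ) : H a = G (b * a + c) :=
    tendsto_nhds_unique (hH a)
      (tendsto_of_monotone_of_tendsto hC hG h ((tβ.mul_const a).add tγ))
  have hb0 : 0 ≤ b := ge_of_tendsto tβ (Eventually.of_forall fun n => (hβ n).le)
  refine ⟨b, c, hb0.lt_of_ne fun h0 => hb ?_, hall⟩
  rw [hall, hall, ← h0]
  simp

/-- A non-constant real random variable takes two thresholds with nondegenerate probability. -/
lemma exists_two_nondegenerate_thresholds {Ω : Type*} [MeasurableSpace Ω] (P : Measure Ω)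
    [IsProbabilityMeasure P] (Y : Ω → ℝ) (hY : Measurable Y)
    (hc : ¬ ∃ c : ℝ, ∀ᵐ ω ∂P, Y ω = c) :
    (∃ a₁ a₂ : ℝ, a₁ < a₂ ∧ (P {ω | Y ω ≤ a₁}).toReal ∈ Set.Ioo (0 : ℝ) 1 ∧
      (P {ω | Y ω ≤ a₂}).toReal ∈ Set.Ioo (0 : ℝ) 1) ∧
    ∃ b₁ b₂ : ℝ, (P {ω | Y ω ≤ b₁}).toReal ≠ (P {ω | Y ω ≤ b₂}).toReal := by
  have hmap : IsProbabilityMeasure (P.map Y) := Measure.isProbabilityMeasure_map hY.aemeasurable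
  set H : ℝ → ℝ := fun a => (P {ω | Y ω ≤ a}).toReal with hH
  have e (a : ℝ) : H a = ProbabilityTheory.cdf (P.map Y) a := by
    rw [ProbabilityTheory.cdf_eq_real, measureReal_def, Measure.map_apply hY measurableSet_Iic]
    rfl
  have hbot : Tendsto H atBot (𝓝 0) :=
    (ProbabilityTheory.tendsto_cdf_atBot (P.map Y)).congr fun a => (e a).symm
  have htop : Tendsto H atTop (𝓝 1) :=
    (ProbabilityTheory.tendsto_cdf_atTop (P.map Y)).congr fun a => (e a).symm
  have hmono : Monotone H := by
    intro a b hab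
    rw [e, e]
    exact ProbabilityTheory.monotone_cdf _ hab
  have h0 (a : ℝ) : 0 ≤ H a := ENNReal.toReal_nonneg
  have h1 (a : ℝ) : H a ≤ 1 := measureReal_le_one
  have hright (a : ℝ) : ContinuousWithinAt H (Set.Ici a) a := by
    have := (ProbabilityTheory.cdf (P.map Y)).right_continuous a
    refine this.congr (fun y _ => e y) (e a)
  have hex : ∃ a, H a ∈ Set.Ioo (0 : ℝ) 1 := by
    by_contra hn
    have hn' (a : ℝ) : H a = 0 ∨ H a = 1 := by
      by_contra hh
      rw [not_or] at hh
      exact hn ⟨a, (h0 a).lt_of_ne (Ne.symm hh.1), (h1 a).lt_of_ne hh.2⟩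
    apply hc
    have hsep : ∀ U : Set ℝ, U ∈ Set.range (Set.Iic : ℝ → Set ℝ) →
        (∀ᵐ ω ∂P, Y ω ∈ U) ∨ (∀ᵐ ω ∂P, Y ω ∉ U) := by
      rintro U ⟨a, rfl⟩
      have hm : MeasurableSet {ω | Y ω ≤ a} := hY measurableSet_Iic
      rcases hn' a with h | h
      · right
        rw [ae_iff]
        simp only [Set.mem_Iic, not_not]
        rcases (ENNReal.toReal_eq_zero_iff _).1 h with h | h
        · exact h
        · exact absurd h (measure_ne_top P _)
      · left
        have : P {ω | Y ω ≤ a} = 1 := by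
          rw [← ENNReal.ofReal_toReal (measure_ne_top P {ω | Y ω ≤ a})]
          rw [show (P {ω | Y ω ≤ a}).toReal = 1 from h, ENNReal.ofReal_one]
        exact (prob_compl_eq_zero_iff hm).2 this
    exact exists_eventuallyEq_const_of_forall_separating (l := ae P) (f := Y) _ hsep
  obtain ⟨a, ha⟩ := hex
  refine ⟨?_, ?_⟩
  · have hev : ∀ᶠ b in 𝓝[>] a, H b < 1 :=
      ((hright a).mono Set.Ioi_subset_Ici_self).eventually_lt continuousWithinAt_const ha.2
    obtain ⟨b, hb, hab⟩ := (hev.and self_mem_nhdsWithin).exists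
    exact ⟨a, b, hab, ha, ha.1.trans_le (hmono (le_of_lt hab)), hb⟩
  · obtain ⟨b, hb⟩ := (htop.eventually_const_lt ha.2).exists
    exact ⟨a, b, hb.ne⟩

lemma abs_sum_mul_sub_integral_le (g : ℝ → ℝ) (Λ : ℝ) (hg : ∀ s t, |g s - g t| ≤ Λ * |s - t|)
    (hΛ : 0 ≤ Λ) (hc : Continuous g) (θ : ℝ) (hθ : 0 ≤ θ) (m : ℕ) :
    |∑ k ∈ Finset.range m, θ * g (k * θ) - ∫ t in (0 : ℝ)..(m * θ), g t| ≤ m * (Λ * θ * θ) := by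
  have h1 := intervalIntegral.sum_integral_adjacent_intervals (μ := volume) (f := g)
    (a := fun k : ℕ => (k : ℝ) * θ) (n := m) fun k _ => hc.intervalIntegrable _ _
  simp only [Nat.cast_zero, zero_mul] at h1
  rw [← h1, ← Finset.sum_sub_distrib]
  refine (Finset.abs_sum_le_sum_abs _ _).trans ?_
  refine (Finset.sum_le_card_nsmul _ _ (Λ * θ * θ) fun k _ => ?_).trans (by simp)
  have hlen : ((k + 1 : ℕ) : ℝ) * θ - k * θ = θ := by push_cast; ring
  have h2 : θ * g (k * θ) = ∫ _ in ((k : ℝ) * θ)..((k + 1 : ℕ) * θ), g (k * θ) := by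
    rw [intervalIntegral.integral_const, hlen, smul_eq_mul]
  rw [h2, ← intervalIntegral.integral_sub (by simp) (hc.intervalIntegrable _ _)]
  have h3 := intervalIntegral.norm_integral_le_of_norm_le_const (C := Λ * θ)
    (f := fun t => g (k * θ) - g t) (a := (k : ℝ) * θ) (b := ((k + 1 : ℕ) : ℝ) * θ) fun t ht => by
      rw [Set.uIoc_of_le (by nlinarith)] at ht
      refine (hg _ _).trans (mul_le_mul_of_nonneg_left ?_ hΛ)
      rw [abs_le]
      constructor <;> linarith [ht.1, ht.2]
  rwa [hlen, abs_of_nonneg hθ, Real.norm_eq_abs] at h3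

lemma tendsto_natFloor_mul {ι : Type*} {l : Filter ι} {θ : ι → ℝ} (hθ : ∀ n, 0 < θ n)
    (h0 : Tendsto θ l (𝓝 0)) {T : ℝ} (hT : 0 ≤ T) :
    Tendsto (fun n => (⌊T / θ n⌋₊ : ℝ) * θ n) l (𝓝 T) := by
  refine tendsto_of_tendsto_of_tendsto_of_le_of_le (g := fun n => T - θ n) (h := fun _ => T) ?_
    tendsto_const_nhds (fun n => ?_) fun n => ?_
  · simpa using h0.const_sub T
  · have := Nat.lt_floor_add_one (T / θ n)
    rw [div_lt_iff₀ (hθ n)] at this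
    show T - θ n ≤ _
    linarith
  · have := Nat.floor_le (div_nonneg hT (hθ n).le)
    rwa [le_div_iff₀ (hθ n)] at this

lemma tendsto_natFloor_atTop {ι : Type*} {l : Filter ι} {θ : ι → ℝ} (hθ : ∀ n, 0 < θ n)
    (h0 : Tendsto θ l (𝓝 0)) {T : ℝ} (hT : 0 < T) : Tendsto (fun n => ⌊T / θ n⌋₊) l atTop := by
  refine tendsto_nat_floor_atTop.comp ?_
  simp_rw [div_eq_mul_inv]
  exact (tendsto_inv_nhdsGT_zero.comp
    (tendsto_nhdsWithin_iff.2 ⟨h0, Eventually.of_forall hθ⟩)).const_mul_atTop hT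

lemma tendsto_mean_sampled {ι : Type*} {l : Filter ι} (g : ℝ → ℝ) (Λ : ℝ)
    (hg : ∀ s t, |g s - g t| ≤ Λ * |s - t|) (hΛ : 0 ≤ Λ) (hc : Continuous g) {θ : ι → ℝ}
    (hθ : ∀ n, 0 < θ n) (h0 : Tendsto θ l (𝓝 0)) {T : ℝ} (hT : 0 < T) :
    Tendsto (fun n => (∑ k ∈ Finset.range ⌊T / θ n⌋₊, g (k * θ n)) / (⌊T / θ n⌋₊ : ℝ)) l
      (𝓝 ((∫ t in (0 : ℝ)..T, g t) / T)) := by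
  have hmul := tendsto_natFloor_mul hθ h0 hT.le
  have hintg : Tendsto (fun n => (∫ t in (0 : ℝ)..(⌊T / θ n⌋₊ * θ n), g t) / (⌊T / θ n⌋₊ * θ n)) l
      (𝓝 ((∫ t in (0 : ℝ)..T, g t) / T)) := by
    refine Tendsto.div ?_ hmul hT.ne'
    exact ((intervalIntegral.continuous_primitive
      (fun a b => hc.intervalIntegrable a b) 0).tendsto T).comp hmul
  have herr : Tendsto (fun n => Λ * θ n) l (𝓝 0) := by simpa using h0.const_mul Λ
  have hpos := (tendsto_natFloor_atTop hθ h0 hT).eventually_gt_atTop 0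
  have hdiff : Tendsto (fun n => (∑ k ∈ Finset.range ⌊T / θ n⌋₊, g (k * θ n)) / (⌊T / θ n⌋₊ : ℝ) -
      (∫ t in (0 : ℝ)..(⌊T / θ n⌋₊ * θ n), g t) / (⌊T / θ n⌋₊ * θ n)) l (𝓝 0) := by
    refine squeeze_zero_norm' ?_ herr
    filter_upwards [hpos] with n hn
    have hm : (0 : ℝ) < ⌊T / θ n⌋₊ := by exact_mod_cast hn
    have hmθ := mul_pos hm (hθ n)
    have h1 := abs_sum_mul_sub_integral_le g Λ hg hΛ hc (θ n) (hθ n).le ⌊T / θ n⌋₊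
    have e : (∑ k ∈ Finset.range ⌊T / θ n⌋₊, g (k * θ n)) / (⌊T / θ n⌋₊ : ℝ) -
      (∫ t in (0 : ℝ)..(⌊T / θ n⌋₊ * θ n), g t) / (⌊T / θ n⌋₊ * θ n) =
      (∑ k ∈ Finset.range ⌊T / θ n⌋₊, θ n * g (k * θ n) -
        ∫ t in (0 : ℝ)..(⌊T / θ n⌋₊ * θ n), g t) / (⌊T / θ n⌋₊ * θ n) := by
      rw [← Finset.mul_sum]
      have := (hθ n).ne'
      field_simp
    rw [e, Real.norm_eq_abs, abs_div, abs_of_pos hmθ, div_le_iff₀ hmθ]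
    refine h1.trans (le_of_eq (by ring))
  have := hdiff.add hintg
  rw [zero_add] at this
  exact this.congr fun n => by ring

lemma abs_sum_range_mul_sub_le (φ : ℝ → ℝ) (Λ : ℝ) (hφ : ∀ s t, |φ s - φ t| ≤ Λ * |s - t|)
    (hΛ : 0 ≤ Λ) (V ρ G : ℕ → ℝ) (m q : ℕ) (e s : ℝ)
    (hV : ∀ k < m, ∀ r < q, |V (k * q + r) - ρ r - G k| ≤ e)
    (hρ : ∑ r ∈ Finset.range q, |ρ r| ≤ q * s) :
    |∑ N ∈ Finset.range (m * q), φ (V N) - q * ∑ k ∈ Finset.range m, φ (G k)| ≤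
      m * q * (Λ * (e + s)) := by
  have h1 := sum_range_mul_add_eq (fun N => φ (V N)) m q 0
  simp only [add_zero, Finset.range_zero, Finset.sum_empty] at h1
  rw [h1, Finset.mul_sum, ← Finset.sum_sub_distrib]
  refine (Finset.abs_sum_le_sum_abs _ _).trans ?_
  refine (Finset.sum_le_card_nsmul _ _ (q * (Λ * (e + s))) fun k hk => ?_).trans
    (by rw [Finset.card_range, nsmul_eq_mul, mul_assoc])
  have h2 : (q : ℝ) * φ (G k) = ∑ _r ∈ Finset.range q, φ (G k) := by simp
  rw [h2, ← Finset.sum_sub_distrib]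
  refine (Finset.abs_sum_le_sum_abs _ _).trans ?_
  calc ∑ r ∈ Finset.range q, |φ (V (k * q + r)) - φ (G k)|
      ≤ ∑ r ∈ Finset.range q, Λ * (e + |ρ r|) := by
        refine Finset.sum_le_sum fun r hr => (hφ _ _).trans (mul_le_mul_of_nonneg_left ?_ hΛ)
        have h3 := hV k (Finset.mem_range.1 hk) r (Finset.mem_range.1 hr)
        have h4 : V (k * q + r) - G k = (V (k * q + r) - ρ r - G k) + ρ r := by ring
        rw [h4]
        exact (abs_add_le _ _).trans (add_le_add h3 le_rfl)
    _ = Λ * (q * e + ∑ r ∈ Finset.range q, |ρ r|) := by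
        rw [← Finset.mul_sum, Finset.sum_add_distrib]; simp
    _ ≤ Λ * (q * e + q * s) := by gcongr
    _ = q * (Λ * (e + s)) := by ring

/-- The piecewise linear function equal to `1` below `y` and to `0` above `y + η`. -/
noncomputable def ramp (y η z : ℝ) : ℝ := max 0 (min 1 ((y + η - z) / η))

lemma abs_ramp_sub_le (y η : ℝ) (hη : 0 < η) (s t : ℝ) :
    |ramp y η s - ramp y η t| ≤ η⁻¹ * |s - t| := by
  unfold ramp
  rw [max_comm 0, max_comm 0]
  refine (abs_max_sub_max_le_abs _ _ _).trans ((abs_min_sub_min_le_max _ _ _ _).trans ?_)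
  have : (y + η - s) / η - (y + η - t) / η = η⁻¹ * (t - s) := by field_simp; ring
  rw [this, abs_mul, abs_of_pos (inv_pos.2 hη), abs_sub_comm t s, sub_self, abs_zero]
  exact max_le (by positivity) le_rfl

lemma ramp_nonneg (y η z : ℝ) : 0 ≤ ramp y η z := le_max_left _ _

lemma ramp_le_one (y η z : ℝ) : ramp y η z ≤ 1 := max_le zero_le_one (min_le_left _ _)

lemma ramp_eq_one (y η z : ℝ) (hη : 0 < η) (h : z ≤ y) : ramp y η z = 1 := by
  unfold ramp
  rw [min_eq_left ((one_le_div hη).2 (by linarith)), max_eq_right zero_le_one]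

lemma ramp_eq_zero (y η z : ℝ) (hη : 0 < η) (h : y + η ≤ z) : ramp y η z = 0 := by
  unfold ramp
  exact max_eq_left ((min_le_right _ _).trans (div_nonpos_of_nonpos_of_nonneg (by linarith) hη.le))

lemma continuous_ramp (y η : ℝ) : Continuous (ramp y η) := by
  unfold ramp
  fun_prop

lemma integral_indicator_div_eq_occupationCDF (F : ℝ → ℝ) (hF : Continuous F) (T y : ℝ)
    (hT : 0 ≤ T) : (∫ t in (0 : ℝ)..T, {t | F t ≤ y}.indicator (1 : ℝ → ℝ) t) / T =
      occupationCDF F T y := by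
  have hmeas : MeasurableSet {t | F t ≤ y} := (isClosed_le hF continuous_const).measurableSet
  rw [intervalIntegral.integral_of_le hT, integral_indicator_one hmeas,
    measureReal_restrict_apply hmeas, Set.inter_comm]
  rfl

lemma occupationCDF_le_integral_ramp (F : ℝ → ℝ) (hF : Continuous F) (T y η : ℝ) (hT : 0 ≤ T)
    (hη : 0 < η) : occupationCDF F T y ≤ (∫ t in (0 : ℝ)..T, ramp y η (F t)) / T := by
  rw [← integral_indicator_div_eq_occupationCDF F hF T y hT]
  have hmeas : MeasurableSet {t | F t ≤ y} := (isClosed_le hF continuous_const).measurableSet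
  refine div_le_div_of_nonneg_right (intervalIntegral.integral_mono_on hT ?_
    (((continuous_ramp y η).comp hF).intervalIntegrable _ _) fun t _ => ?_) hT
  · rw [intervalIntegrable_iff, Set.uIoc_of_le hT]
    exact (integrable_const (1 : ℝ)).indicator hmeas
  · by_cases h : t ∈ {t | F t ≤ y}
    · rw [Set.indicator_of_mem h, ramp_eq_one _ _ _ hη h]; rfl
    · rw [Set.indicator_of_notMem h]; exact ramp_nonneg _ _ _

lemma integral_ramp_le_occupationCDF (F : ℝ → ℝ) (hF : Continuous F) (T y η : ℝ) (hT : 0 ≤ T)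
    (hη : 0 < η) : (∫ t in (0 : ℝ)..T, ramp y η (F t)) / T ≤ occupationCDF F T (y + η) := by
  rw [← integral_indicator_div_eq_occupationCDF F hF T _ hT]
  have hmeas : MeasurableSet {t | F t ≤ y + η} := (isClosed_le hF continuous_const).measurableSet
  refine div_le_div_of_nonneg_right (intervalIntegral.integral_mono_on hT
    (((continuous_ramp y η).comp hF).intervalIntegrable _ _) ?_ fun t _ => ?_) hT
  · rw [intervalIntegrable_iff, Set.uIoc_of_le hT]
    exact (integrable_const (1 : ℝ)).indicator hmeas
  · by_cases h : t ∈ {t | F t ≤ y + η}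
    · rw [Set.indicator_of_mem h]; exact ramp_le_one _ _ _
    · rw [Set.indicator_of_notMem h, ramp_eq_zero _ _ _ hη (le_of_lt (not_le.1 h))]

lemma sum_Icc_one_le (f : ℕ → ℝ) (h0 : ∀ n, 0 ≤ f n) (h1 : ∀ n, f n ≤ 1) (M : ℕ) :
    |∑ n ∈ Finset.Icc 1 M, f n - ∑ n ∈ Finset.range M, f n| ≤ 1 := by
  have e : ∑ n ∈ Finset.Icc 1 M, f n + f 0 = ∑ n ∈ Finset.range M, f n + f M := by
    rw [← Finset.sum_range_succ]
    induction M with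
    | zero => simp
    | succ M ih => rw [Finset.sum_Icc_succ_top (by omega), Finset.sum_range_succ, ← ih]; ring
  rw [abs_le]
  constructor <;> linarith [h0 0, h0 M, h1 0, h1 M]

lemma card_filter_le_sum_ramp (V : ℕ → ℝ) (y η : ℝ) (hη : 0 < η) (M : ℕ) :
    (((Finset.Icc 1 M).filter fun N => V N ≤ y).card : ℝ) ≤
      ∑ N ∈ Finset.range M, ramp y η (V N) + 1 := by
  have h := abs_le.1 (sum_Icc_one_le (fun N => ramp y η (V N)) (fun _ => ramp_nonneg _ _ _)
    (fun _ => ramp_le_one _ _ _) M)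
  have : (((Finset.Icc 1 M).filter fun N => V N ≤ y).card : ℝ) ≤
      ∑ N ∈ Finset.Icc 1 M, ramp y η (V N) := by
    rw [Finset.card_filter, Nat.cast_sum]
    refine Finset.sum_le_sum fun N _ => ?_
    split_ifs with hN
    · simp [ramp_eq_one _ _ _ hη hN]
    · simpa using ramp_nonneg _ _ _
  linarith [h.2]

lemma sum_ramp_le_card_filter (V : ℕ → ℝ) (y η : ℝ) (hη : 0 < η) (M : ℕ) :
    ∑ N ∈ Finset.range M, ramp (y - η) η (V N) - 1 ≤
      (((Finset.Icc 1 M).filter fun N => V N ≤ y).card : ℝ) := by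
  have h := abs_le.1 (sum_Icc_one_le (fun N => ramp (y - η) η (V N)) (fun _ => ramp_nonneg _ _ _)
    (fun _ => ramp_le_one _ _ _) M)
  have : ∑ N ∈ Finset.Icc 1 M, ramp (y - η) η (V N) ≤
      (((Finset.Icc 1 M).filter fun N => V N ≤ y).card : ℝ) := by
    rw [Finset.card_filter, Nat.cast_sum]
    refine Finset.sum_le_sum fun N _ => ?_
    split_ifs with hN
    · simpa using ramp_le_one _ _ _
    · rw [ramp_eq_zero _ _ _ hη (by linarith [not_le.1 hN])]; simp
  linarith [h.1]

/-- If a sequence follows, up to small errors, a slowly sampled curve `F` then its empirical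
distribution over a long window is close to the occupation distribution of `F`. -/
lemma tendsto_card_filter_div {ι : Type*} {l : Filter ι} (F : ℝ → ℝ) (Λ : ℝ)
    (hF : ∀ s t, |F s - F t| ≤ Λ * |s - t|) (hΛ : 0 ≤ Λ) (hc : Continuous F)
    (hlev : ∀ y, volume {t | F t = y} = 0) {θ : ι → ℝ} (hθ : ∀ n, 0 < θ n)
    (h0 : Tendsto θ l (𝓝 0)) {T : ℝ} (hT : 0 < T) (q : ι → ℕ) (hq : ∀ n, 0 < q n)
    (V ρ : ι → ℕ → ℝ) (e s : ι → ℝ) (he : Tendsto e l (𝓝 0)) (hs : Tendsto s l (𝓝 0))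
    (hV : ∀ᶠ n in l, ∀ k < ⌊T / θ n⌋₊, ∀ r < q n,
      |V n (k * q n + r) - ρ n r - F (k * θ n)| ≤ e n)
    (hρ : ∀ n, ∑ r ∈ Finset.range (q n), |ρ n r| ≤ q n * s n) (y : ℝ) :
    Tendsto (fun n => (((Finset.Icc 1 (⌊T / θ n⌋₊ * q n)).filter fun N => V n N ≤ y).card : ℝ) /
      ((⌊T / θ n⌋₊ * q n : ℕ) : ℝ)) l (𝓝 (occupationCDF F T y)) := by
  have hm := tendsto_natFloor_atTop hθ h0 hT
  have hM : Tendsto (fun n => ⌊T / θ n⌋₊ * q n) l atTop :=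
    tendsto_atTop_mono (fun n => Nat.le_mul_of_pos_right _ (hq n)) hm
  have hMpos := hM.eventually_gt_atTop 0
  have hinv : Tendsto (fun n => 1 / ((⌊T / θ n⌋₊ * q n : ℕ) : ℝ)) l (𝓝 0) :=
    tendsto_one_div_atTop_nhds_zero_nat.comp hM
  have hmean (z η : ℝ) (hη : 0 < η) : Tendsto (fun n =>
      (∑ N ∈ Finset.range (⌊T / θ n⌋₊ * q n), ramp z η (V n N)) /
        ((⌊T / θ n⌋₊ * q n : ℕ) : ℝ)) l (𝓝 ((∫ t in (0 : ℝ)..T, ramp z η (F t)) / T)) := by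
    have h1 := tendsto_mean_sampled (l := l) (fun t => ramp z η (F t)) (η⁻¹ * Λ)
      (fun a b => (abs_ramp_sub_le z η hη _ _).trans
        (by rw [mul_assoc]; exact mul_le_mul_of_nonneg_left (hF a b) (inv_pos.2 hη).le))
      (by positivity) ((continuous_ramp z η).comp hc) hθ h0 hT
    have h2 : Tendsto (fun n => η⁻¹ * (e n + s n)) l (𝓝 0) := by
      simpa using (he.add hs).const_mul η⁻¹
    have h3 : Tendsto (fun n => (∑ N ∈ Finset.range (⌊T / θ n⌋₊ * q n), ramp z η (V n N)) /
        ((⌊T / θ n⌋₊ * q n : ℕ) : ℝ) -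
        (∑ k ∈ Finset.range ⌊T / θ n⌋₊, ramp z η (F (k * θ n))) / (⌊T / θ n⌋₊ : ℝ)) l (𝓝 0) := by
      refine squeeze_zero_norm' ?_ h2
      filter_upwards [hMpos, hm.eventually_gt_atTop 0, hV] with n hn hn' hVn
      have hn1 : (0 : ℝ) < ⌊T / θ n⌋₊ := by exact_mod_cast hn'
      have hq1 : (0 : ℝ) < q n := by exact_mod_cast hq n
      have h4 := abs_sum_range_mul_sub_le (ramp z η) η⁻¹ (abs_ramp_sub_le z η hη)
        (inv_pos.2 hη).le (V n) (ρ n) (fun k => F (k * θ n)) ⌊T / θ n⌋₊ (q n) (e n) (s n)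
        hVn (hρ n)
      have e1 : (∑ N ∈ Finset.range (⌊T / θ n⌋₊ * q n), ramp z η (V n N)) /
          ((⌊T / θ n⌋₊ * q n : ℕ) : ℝ) -
          (∑ k ∈ Finset.range ⌊T / θ n⌋₊, ramp z η (F (k * θ n))) / (⌊T / θ n⌋₊ : ℝ) =
          (∑ N ∈ Finset.range (⌊T / θ n⌋₊ * q n), ramp z η (V n N) -
            q n * ∑ k ∈ Finset.range ⌊T / θ n⌋₊, ramp z η (F (k * θ n))) /
            (⌊T / θ n⌋₊ * q n) := by
        push_cast
        field_simp
      rw [e1, Real.norm_eq_abs, abs_div, abs_of_pos (mul_pos hn1 hq1),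
        div_le_iff₀ (mul_pos hn1 hq1)]
      exact h4.trans (le_of_eq (by ring))
    have h5 := h3.add h1
    rw [zero_add] at h5
    exact h5.congr fun n => by ring
  rw [Metric.tendsto_nhds]
  intro ε hε
  obtain ⟨δ, hδ, hd⟩ := Metric.continuousAt_iff.1
    ((continuous_occupationCDF F hc hlev T).continuousAt (x := y)) (ε / 3) (by linarith)
  set η := δ / 2 with hηδ
  have hη : 0 < η := by positivity
  have b1 := hd (x := y + η) (by rw [Real.dist_eq, abs_lt]; constructor <;> linarith)
  have b2 := hd (x := y - η) (by rw [Real.dist_eq, abs_lt]; constructor <;> linarith)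
  have c1 := integral_ramp_le_occupationCDF F hc T y η hT.le hη
  have c2 := occupationCDF_le_integral_ramp F hc T (y - η) η hT.le hη
  filter_upwards [Metric.tendsto_nhds.1 (hmean y η hη) (ε / 3) (by linarith),
    Metric.tendsto_nhds.1 (hmean (y - η) η hη) (ε / 3) (by linarith),
    Metric.tendsto_nhds.1 hinv (ε / 3) (by linarith), hMpos] with n a1 a2 a3 hn
  have hn1 : (0 : ℝ) < ((⌊T / θ n⌋₊ * q n : ℕ) : ℝ) := by exact_mod_cast hn
  have d1 := div_le_div_of_nonneg_right (card_filter_le_sum_ramp (V n) y η hη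
    (⌊T / θ n⌋₊ * q n)) hn1.le
  have d2 := div_le_div_of_nonneg_right (sum_ramp_le_card_filter (V n) y η hη
    (⌊T / θ n⌋₊ * q n)) hn1.le
  rw [add_div] at d1
  rw [sub_div] at d2
  rw [Real.dist_eq, abs_lt] at *
  constructor <;> linarith

lemma sawPrimitive_add_intCast (w : ℝ) (n : ℤ) : sawPrimitive (w + n) = sawPrimitive w := by
  unfold sawPrimitive
  rw [Int.fract_add_intCast]

lemma sawPrimitive_fract_add (w t : ℝ) : sawPrimitive (Int.fract w + t) = sawPrimitive (w + t) := by
  rw [← sawPrimitive_add_intCast (w + t) (-⌊w⌋)]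
  congr 1
  unfold Int.fract
  push_cast
  ring

lemma abs_sawPrimitive_le (w : ℝ) : |sawPrimitive w| ≤ 1 / 2 := by
  unfold sawPrimitive
  have h0 := Int.fract_nonneg w
  have h1 := Int.fract_lt_one w
  rw [abs_le]
  constructor <;> nlinarith

lemma countable_sawPrimitive_eq (c : ℝ) : {w | sawPrimitive w = c}.Countable := by
  refine Set.Countable.mono (s₂ := (Set.range fun n : ℤ => (n : ℝ) + (1 / 2 + √(2 * c + 1 / 4))) ∪
    Set.range fun n : ℤ => (n : ℝ) + (1 / 2 - √(2 * c + 1 / 4))) ?_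
    ((Set.countable_range _).union (Set.countable_range _))
  intro w hw
  have hw' : (Int.fract w ^ 2 - Int.fract w) / 2 = c := hw
  have h : 2 * c + 1 / 4 = (Int.fract w - 1 / 2) ^ 2 := by rw [← hw']; ring
  have hfl := Int.floor_add_fract w
  rw [h, Real.sqrt_sq_eq_abs]
  rcases abs_cases (Int.fract w - 1 / 2) with ⟨h1, -⟩ | ⟨h1, -⟩
  · refine Or.inl ⟨⌊w⌋, ?_⟩
    simp only [h1]
    linarith
  · refine Or.inr ⟨⌊w⌋, ?_⟩
    simp only [h1]
    linarith

/-- The limiting shape of the renormalised sums: the parabola `sawPrimitive`, traversed from `u`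
in the direction `σ`. -/
noncomputable def sawProfile (u σ t : ℝ) : ℝ := σ * (sawPrimitive (u + σ * t) - sawPrimitive u)

lemma abs_sawProfile_sub_le (u σ : ℝ) (hσ : |σ| = 1) (s t : ℝ) :
    |sawProfile u σ s - sawProfile u σ t| ≤ 1 / 2 * |s - t| := by
  have e : sawProfile u σ s - sawProfile u σ t =
      σ * (sawPrimitive (u + σ * s) - sawPrimitive (u + σ * t)) := by
    unfold sawProfile; ring
  have h := abs_sawPrimitive_sub_le (u + σ * s) (u + σ * t)
  have e2 : u + σ * s - (u + σ * t) = σ * (s - t) := by ring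
  rw [e2, abs_mul, hσ, one_mul] at h
  rw [e, abs_mul, hσ, one_mul]
  linarith

lemma continuous_sawProfile (u σ : ℝ) (hσ : |σ| = 1) : Continuous (sawProfile u σ) := by
  refine (LipschitzWith.of_dist_le_mul (K := 1 / 2) fun s t => ?_).continuous
  simpa [Real.dist_eq] using abs_sawProfile_sub_le u σ hσ s t

lemma periodic_sawProfile (u σ : ℝ) (hσ : |σ| = 1) : Function.Periodic (sawProfile u σ) 1 := by
  intro t
  have : ∃ n : ℤ, σ = n := by
    rcases eq_or_eq_neg_of_abs_eq hσ with h | h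
    · exact ⟨1, by simpa using h⟩
    · exact ⟨-1, by simpa using h⟩
  obtain ⟨n, hn⟩ := this
  unfold sawProfile
  rw [show u + σ * (t + 1) = u + σ * t + n by rw [← hn]; ring, sawPrimitive_add_intCast]

lemma volume_sawProfile_eq (u σ : ℝ) (hσ : |σ| = 1) (y : ℝ) :
    volume {t | sawProfile u σ t = y} = 0 := by
  have h0 : σ ≠ 0 := by rintro rfl; simp at hσ
  have hinj : Function.Injective fun t => u + σ * t := by
    intro a b hab
    simpa [h0] using hab
  refine Set.Countable.measure_zero (Set.Countable.mono (fun t ht => ?_)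
    ((countable_sawPrimitive_eq (y / σ + sawPrimitive u)).preimage hinj)) _
  have ht' : σ * (sawPrimitive (u + σ * t) - sawPrimitive u) = y := ht
  show sawPrimitive (u + σ * t) = y / σ + sawPrimitive u
  rw [← ht']
  field_simp
  ring

lemma abs_sawProfile_le (u σ : ℝ) (hσ : |σ| = 1) (t : ℝ) : |sawProfile u σ t| ≤ 1 := by
  unfold sawProfile
  rw [abs_mul, hσ, one_mul]
  have h1 := abs_sawPrimitive_le (u + σ * t)
  have h2 := abs_sawPrimitive_le u
  exact (abs_sub _ _).trans (by linarith)

lemma abs_sawProfile_sub_base_le (u u' σ : ℝ) (hσ : |σ| = 1) (t : ℝ) :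
    |sawProfile u σ t - sawProfile u' σ t| ≤ |u - u'| := by
  have e : sawProfile u σ t - sawProfile u' σ t =
      σ * ((sawPrimitive (u + σ * t) - sawPrimitive (u' + σ * t)) -
        (sawPrimitive u - sawPrimitive u')) := by
    unfold sawProfile; ring
  have h1 := abs_sawPrimitive_sub_le (u + σ * t) (u' + σ * t)
  have h2 := abs_sawPrimitive_sub_le u u'
  rw [add_sub_add_right_eq_sub] at h1
  rw [e, abs_mul, hσ, one_mul]
  exact (abs_sub _ _).trans (by linarith)

lemma sum_abs_le_of_sum_sq_le (q : ℕ) (g : ℕ → ℝ) (w : ℝ)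
    (h : ∑ r ∈ Finset.range q, g r ^ 2 ≤ q * w) :
    ∑ r ∈ Finset.range q, |g r| ≤ q * √w := by
  have h1 := sq_sum_le_card_mul_sum_sq (s := Finset.range q) (f := fun r => |g r|)
  simp only [Finset.card_range, sq_abs] at h1
  rcases Nat.eq_zero_or_pos q with rfl | hq
  · simp
  have hq' : (0 : ℝ) < q := by exact_mod_cast hq
  have hw : 0 ≤ w := by
    have : 0 ≤ ∑ r ∈ Finset.range q, g r ^ 2 := Finset.sum_nonneg fun _ _ => sq_nonneg _
    by_contra hc
    nlinarith
  refine abs_le_of_sq_le_sq' ?_ (by positivity) |>.2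
  rw [mul_pow, Real.sq_sqrt hw]
  nlinarith

lemma birkhoff_sawtooth_coe (a x : ℝ) (N : ℕ) :
    birkhoff (fun z => iota z - 1 / 2) (a : UnitAddCircle) (x : UnitAddCircle) N =
      ∑ n ∈ Finset.range N, (Int.fract (x + n * a) - 1 / 2) := by
  unfold birkhoff
  refine Finset.sum_congr rfl fun n _ => ?_
  have e : (x : UnitAddCircle) + n • (a : UnitAddCircle) = ((x + n * a : ℝ) : UnitAddCircle) := by
    rw [← nsmul_eq_mul]; rfl
  show iota _ - 1 / 2 = _
  rw [e]
  unfold iota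
  rw [AddCircle.coe_equivIco_mk_apply]
  simp

/-- Birkhoff sums of the sawtooth near a nonresonant rational rotation number are, after
rescaling, uniformly close to a periodic parabolic profile up to an oscillation that is small on
average over one period. -/
lemma exists_profile_approx (q : ℕ) [NeZero q] (p : ℤ) (hp : IsUnit (p : ZMod q)) (x ε θ σ : ℝ)
    (hσ : |σ| = 1) (hθ : 0 < θ) (hθ1 : θ ≤ 1) (hd : (q : ℝ) ^ 2 * ε = σ * θ) (S : ℕ → ℝ)
    (hS : ∀ N, S N = ∑ n ∈ Finset.range N, (Int.fract (x + n * (p / q + ε : ℝ)) - 1 / 2)) :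
    ∃ (D : ℝ) (ρ : ℕ → ℝ),
      (∀ (u T : ℝ) (k r : ℕ), r < q → k * θ ≤ T →
        |θ * S (k * q + r) - D - ρ r - sawProfile u σ (k * θ)| ≤
          θ * (6 * T + 5) + |Int.fract (q * x) - u|) ∧
      ∑ r ∈ Finset.range q, |ρ r| ≤
        q * √(θ ^ 2 * (2 * resonanceSum q (p : ZMod q) + 2)) := by
  obtain ⟨C, hC⟩ := exists_sum_sq_rationalSawSum_le q p hp x
  refine ⟨θ * C, fun r => θ * (rationalSawSum q p x r - C), fun u T k r hr hk => ?_, ?_⟩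
  · have hσ0 : σ ≠ 0 := by rintro rfl; simp at hσ
    have hσσ : σ * σ = 1 := by rw [← abs_mul_abs_self, hσ, one_mul]
    have h := abs_sum_saw_near_rational q p hp x ε (σ * θ) hd.symm (mul_ne_zero hσ0 hθ.ne')
      (by rwa [abs_mul, hσ, one_mul, abs_of_pos hθ]) k hr
    rw [← hS, abs_mul, hσ, one_mul, abs_of_pos hθ] at h
    have h' := mul_le_mul_of_nonneg_left h hθ.le
    have hb := abs_sawProfile_sub_base_le (Int.fract (q * x)) u σ hσ (k * θ)
    have e1 : θ * (σ * θ)⁻¹ = σ := by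
      field_simp
      rw [pow_two, hσσ]
    have e2 : sawProfile (Int.fract (q * x)) σ (k * θ) =
        θ * ((σ * θ)⁻¹ * (sawPrimitive (q * x + k * (σ * θ)) - sawPrimitive (q * x))) := by
      rw [← mul_assoc, e1]
      unfold sawProfile
      have e3 := sawPrimitive_fract_add (q * x) 0
      rw [add_zero, add_zero] at e3
      rw [sawPrimitive_fract_add, e3, mul_left_comm]
    have e4 : θ * S (k * q + r) - θ * C - θ * (rationalSawSum q p x r - C) -
        sawProfile u σ (k * θ) = θ * (S (k * q + r) - rationalSawSum q p x r -
          (σ * θ)⁻¹ * (sawPrimitive (q * x + k * (σ * θ)) - sawPrimitive (q * x))) +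
        (sawProfile (Int.fract (q * x)) σ (k * θ) - sawProfile u σ (k * θ)) := by
      rw [e2]; ring
    rw [e4]
    refine (abs_add_le _ _).trans (add_le_add ?_ hb)
    rw [abs_mul, abs_of_pos hθ]
    exact h'.trans (mul_le_mul_of_nonneg_left (by linarith) hθ.le)
  · refine sum_abs_le_of_sum_sq_le q _ _ ?_
    simp_rw [mul_pow]
    rw [← Finset.mul_sum]
    have := mul_le_mul_of_nonneg_left hC (sq_nonneg θ)
    linarith

lemma sqrt_fluctuation_le (θ W δ : ℝ) (hθ : 0 ≤ θ) (hθδ : θ ≤ δ) (hW : 0 ≤ W)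
    (h : θ * √W ≤ δ) : √(θ ^ 2 * (2 * W + 2)) ≤ 2 * δ := by
  have hδ : 0 ≤ δ := hθ.trans hθδ
  refine Real.sqrt_le_iff.2 ⟨by linarith, ?_⟩
  have h1 : (θ * √W) ^ 2 ≤ δ ^ 2 := pow_le_pow_left₀ (by positivity) h 2
  rw [mul_pow, Real.sq_sqrt hW] at h1
  have h2 : θ ^ 2 ≤ δ ^ 2 := pow_le_pow_left₀ hθ hθδ 2
  nlinarith

lemma exists_eventually_eq_sign_mul_abs {ι : Type*} (𝒰 : Ultrafilter ι) (d : ι → ℝ) :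
    ∃ σ : ℝ, |σ| = 1 ∧ ∀ᶠ n in (𝒰 : Filter ι), d n = σ * |d n| := by
  rcases 𝒰.em fun n => 0 ≤ d n with h | h
  · exact ⟨1, by simp, h.mono fun n hn => by rw [abs_of_nonneg hn, one_mul]⟩
  · exact ⟨-1, by simp, h.mono fun n hn => by rw [abs_of_neg (not_le.1 hn)]; ring⟩

lemma not_satisfiesTDLT_of_nonresonant_approx (α : UnitAddCircle) (x : ℝ)
    (h : ∀ K : ℕ, ∃ (n : ℕ) (p : ℤ) (ε : ℝ), IsUnit (p : ZMod (n + 1)) ∧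
      ((p / (n + 1 : ℕ) + ε : ℝ) : UnitAddCircle) = α ∧ ε ≠ 0 ∧
      |((n + 1 : ℕ) : ℝ) ^ 2 * ε| ≤ 1 / (K + 1) ∧
      |((n + 1 : ℕ) : ℝ) ^ 2 * ε| * √(resonanceSum (n + 1) (p : ZMod (n + 1))) ≤ 1 / (K + 1)) :
    ¬ SatisfiesTDLT (fun z => iota z - 1 / 2) α (x : UnitAddCircle) := by
  rintro ⟨A, B, Ω, mΩ, P, Y, hB, -, hP, hY, hc, hlim⟩
  choose n p ε hp hα hε hd hW using h
  set H : ℝ → ℝ := fun a => (P {ω | Y ω ≤ a}).toReal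
  set S := birkhoff (fun z => iota z - 1 / 2) α (x : UnitAddCircle)
  obtain ⟨⟨a₁, a₂, ha, ha₁, ha₂⟩, b₁, b₂, hb⟩ := exists_two_nondegenerate_thresholds P Y hY hc
  set 𝒰 : Ultrafilter ℕ := hyperfilter ℕ
  have h𝒰 : (𝒰 : Filter ℕ) ≤ atTop := by
    rw [← Nat.cofinite_eq_atTop]; exact hyperfilter_le_cofinite
  set θ : ℕ → ℝ := fun K => |((n K + 1 : ℕ) : ℝ) ^ 2 * ε K| with hθdef
  have hθ (K : ℕ) : 0 < θ K := abs_pos.2 (mul_ne_zero (by positivity) (hε K))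
  have hone : Tendsto (fun K : ℕ => 1 / ((K : ℝ) + 1)) 𝒰 (𝓝 0) :=
    tendsto_one_div_add_atTop_nhds_zero_nat.mono_left h𝒰
  have hθ0 : Tendsto θ 𝒰 (𝓝 0) := squeeze_zero (fun K => (hθ K).le) hd hone
  obtain ⟨σ, hσ, hev⟩ :=
    exists_eventually_eq_sign_mul_abs 𝒰 fun K => ((n K + 1 : ℕ) : ℝ) ^ 2 * ε K
  have hfr : ∀ᶠ K in (𝒰 : Filter ℕ), Int.fract (((n K + 1 : ℕ) : ℝ) * x) ∈ Set.Icc (0 : ℝ) 1 :=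
    Eventually.of_forall fun K => ⟨Int.fract_nonneg _, (Int.fract_lt_one _).le⟩
  obtain ⟨u, -, hu⟩ := isCompact_Icc.ultrafilter_le_nhds'
    (𝒰.map fun K => Int.fract (((n K + 1 : ℕ) : ℝ) * x)) hfr
  have hu' : Tendsto (fun K => Int.fract (((n K + 1 : ℕ) : ℝ) * x)) 𝒰 (𝓝 u) := hu
  have happrox (K : ℕ) : ∃ (D : ℝ) (ρ : ℕ → ℝ),
      (((n K + 1 : ℕ) : ℝ) ^ 2 * ε K = σ * θ K → ∀ (T : ℝ) (k r : ℕ), r < n K + 1 →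
        k * θ K ≤ T → |θ K * S (k * (n K + 1) + r) - D - ρ r - sawProfile u σ (k * θ K)| ≤
          θ K * (6 * T + 5) + |Int.fract (((n K + 1 : ℕ) : ℝ) * x) - u|) ∧
      ∑ r ∈ Finset.range (n K + 1), |ρ r| ≤ (n K + 1 : ℕ) * (2 * (1 / ((K : ℝ) + 1))) := by
    by_cases hs : ((n K + 1 : ℕ) : ℝ) ^ 2 * ε K = σ * θ K
    · obtain ⟨D, ρ, h1, h2⟩ := exists_profile_approx (n K + 1) (p K) (hp K) x (ε K) (θ K) σ hσ
        (hθ K) ((hd K).trans (Nat.one_div_le_one_div (Nat.zero_le K) |>.trans (by simp))) hs S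
        fun N => by
          simp only [S]
          rw [← hα K, birkhoff_sawtooth_coe]
      exact ⟨D, ρ, fun _ => h1 u, h2.trans (mul_le_mul_of_nonneg_left
        (sqrt_fluctuation_le _ _ _ (hθ K).le (hd K) (resonanceSum_nonneg _ _) (hW K))
        (Nat.cast_nonneg _))⟩
    · exact ⟨0, 0, fun h => absurd h hs, by simp; positivity⟩
  choose D ρ hV hρ using happrox
  have hc := continuous_sawProfile u σ hσ
  have hlev := volume_sawProfile_eq u σ hσ
  refine not_forall_occupationCDF_same_type (sawProfile u σ) hc (periodic_sawProfile u σ hσ) hlev H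
    fun T hT => ?_
  have hT0 : 0 < T := by linarith
  set M : ℕ → ℕ := fun K => ⌊T / θ K⌋₊ * (n K + 1) with hM
  have hMtop : Tendsto M 𝒰 atTop :=
    tendsto_atTop_mono (fun K => Nat.le_mul_of_pos_right _ (Nat.succ_pos _))
      (tendsto_natFloor_atTop hθ hθ0 hT0)
  have hCF := tendsto_card_filter_div (l := (𝒰 : Filter ℕ)) (sawProfile u σ) (1 / 2)
    (abs_sawProfile_sub_le u σ hσ) (by norm_num) hc hlev hθ hθ0 hT0 (fun K => n K + 1)
    (fun K => Nat.succ_pos _) (fun K N => θ K * S N - D K) ρ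
    (fun K => θ K * (6 * T + 5) + |Int.fract (((n K + 1 : ℕ) : ℝ) * x) - u|)
    (fun K => 2 * (1 / ((K : ℝ) + 1)))
    (by
      have h1 := (hu'.sub_const u).abs
      rw [sub_self, abs_zero] at h1
      simpa using (hθ0.mul_const (6 * T + 5)).add h1)
    (by simpa using hone.const_mul 2)
    (by
      filter_upwards [hev] with K hK k hk r hr
      refine hV K hK T k r hr ?_
      have h1 : (k : ℝ) ≤ T / θ K :=
        (Nat.cast_le.2 hk.le).trans (Nat.floor_le (div_nonneg hT0.le (hθ K).le))
      rwa [le_div_iff₀ (hθ K)] at h1)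
    hρ
  refine exists_affine_of_tendsto 𝒰 (G := occupationCDF (sawProfile u σ) T)
    (C := fun K y => (((Finset.Icc 1 (M K)).filter fun N => θ K * S N - D K ≤ y).card : ℝ) / M K)
    (fun K y z hyz => ?_) (continuous_occupationCDF _ hc hlev T) hCF (L := -1) (U := 1)
    (occupationCDF_eq_zero _ hlev T (-1) (-1)
      (fun t => (abs_le.1 (abs_sawProfile_le u σ hσ t)).1) le_rfl)
    (occupationCDF_eq_one _ T 1 1 hT0
      (fun t => (abs_le.1 (abs_sawProfile_le u σ hσ t)).2) le_rfl)
    (β := fun K => θ K * B (M K)) (γ := fun K => θ K * A (M K) - D K)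
    (fun K => mul_pos (hθ K) (hB _)) (fun a => ?_) ha ha₁ ha₂ hb
  · refine div_le_div_of_nonneg_right (Nat.cast_le.2 (Finset.card_le_card ?_)) (Nat.cast_nonneg _)
    exact Finset.monotone_filter_right _ fun N _ hN => le_trans hN hyz
  · refine ((hlim a).comp hMtop).congr fun K => ?_
    simp only [Function.comp_apply]
    congr 3
    ext N
    simp only [Finset.mem_filter, and_congr_right_iff]
    intro _
    rw [div_le_iff₀ (hB _), ← mul_le_mul_iff_right₀ (hθ K)]
    constructor <;> intro h <;> nlinarith

/-- For the sawtooth function `s(x) = ι(x) - 1/2`, for a.e. `α` and every `x₀`,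
no temporal distributional limit theorem holds for `S_N(s, α, x₀)`. -/
theorem no_TDLT_sawtooth :
    ∀ᵐ α ∂(volume : Measure UnitAddCircle), ∀ x₀ : UnitAddCircle,
      ¬ SatisfiesTDLT (fun x => iota x - 1/2) α x₀ := by
  filter_upwards [ae_all_iff.2 ae_exists_nonresonant_approx] with α hα x₀
  obtain ⟨x, rfl⟩ := QuotientAddGroup.mk_surjective x₀
  exact not_satisfiesTDLT_of_nonresonant_approx α x hα
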